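/- arXiv:2212.12027 — 3 statements merged into one kernel-verified Lean document; each statement's English description precedes it below -/
import Mathlib

section
/- Let f : R → T be a pure ring homomorphism of commutative Noetherian rings, 𝔞 a proper ideal of R, and M a finitely generated R-module. If T ⊗_R M is 𝔞T-relative maximal Cohen-Macaulay over T, then M is 𝔞-relative maximal Cohen-Macaulay over R. -/
open CategoryTheory TensorProduct

noncomputable section

universe u

/-- The cohomological dimension `cd(𝔞, M)`: the largest `i` (in `ℕ∞`) such that the local
cohomology module `H^i_𝔞(M)` is nonzero. -/
noncomputable def cohDim {R : Type u} [CommRing R] (a : Ideal R)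
    (M : Type u) [AddCommGroup M] [Module R M] : ℕ∞ :=
  sSup ((fun i : ℕ => (i : ℕ∞)) ''
    {i : ℕ | Nontrivial ((localCohomology a i).obj (ModuleCat.of R M))})

/-- The grade `grade(𝔞, M)`: the least `i` (in `ℕ∞`) such that `Ext^i_R(R/𝔞, M) ≠ 0`. -/
noncomputable def relGrade {R : Type u} [CommRing R] (a : Ideal R)
    (M : Type u) [AddCommGroup M] [Module R M] : ℕ∞ :=
  sInf ((fun i : ℕ => (i : ℕ∞)) ''
    {i : ℕ | Nontrivial (((Ext R (ModuleCat.{u} R) i).obj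
      (Opposite.op (ModuleCat.of R (R ⧸ a)))).obj (ModuleCat.of R M))})

/-- `M` is `𝔞`-relative Cohen-Macaulay: `M = 𝔞M`, or `M ≠ 𝔞M` and `grade(𝔞,M) = cd(𝔞,M)`. -/
def IsRelCM {R : Type u} [CommRing R] (a : Ideal R)
    (M : Type u) [AddCommGroup M] [Module R M] : Prop :=
  a • (⊤ : Submodule R M) = ⊤ ∨
    (a • (⊤ : Submodule R M) ≠ ⊤ ∧ relGrade a M = cohDim a M)

/-- `M` is `𝔞`-relative maximal Cohen-Macaulay: `grade(𝔞,M) = cd(𝔞,R)`. -/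
def IsRelMCM {R : Type u} [CommRing R] (a : Ideal R)
    (M : Type u) [AddCommGroup M] [Module R M] : Prop :=
  relGrade a M = cohDim a R

/-- `M` is `𝔞`-relative Gorenstein: `Ext^i_R(R/𝔞, M) = 0` for all `i ≠ cd(𝔞,R)`. -/
def IsRelGorenstein {R : Type u} [CommRing R] (a : Ideal R)
    (M : Type u) [AddCommGroup M] [Module R M] : Prop :=
  ∀ i : ℕ, (i : ℕ∞) ≠ cohDim a R →
    Subsingleton (((Ext R (ModuleCat.{u} R) i).obj
      (Opposite.op (ModuleCat.of R (R ⧸ a)))).obj (ModuleCat.of R M))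

/-- `M` is `𝔞`-relative regular: `M = 𝔞M`, or `M ≠ 𝔞M` and `𝔞` is generated by a sequence of
length `cd(𝔞,R)` which is both an `M`-regular sequence and an `R`-regular sequence. -/
def IsRelRegular {R : Type u} [CommRing R] (a : Ideal R)
    (M : Type u) [AddCommGroup M] [Module R M] : Prop :=
  a • (⊤ : Submodule R M) = ⊤ ∨
    (a • (⊤ : Submodule R M) ≠ ⊤ ∧ ∃ rs : List R,
      (rs.length : ℕ∞) = cohDim a R ∧ Ideal.span {x | x ∈ rs} = a ∧
      RingTheory.Sequence.IsRegular M rs ∧ RingTheory.Sequence.IsRegular R rs)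

/-- A ring map (given as an algebra) `R → T` is pure if `N → T ⊗[R] N`, `n ↦ 1 ⊗ n`,
is injective for every `R`-module `N`. -/
def IsPureAlgebra (R T : Type u) [CommRing R] [CommRing T] [Algebra R T] : Prop :=
  ∀ (N : Type u) [AddCommGroup N] [Module R N],
    Function.Injective (fun n : N => (1 : T) ⊗ₜ[R] n)

section Comparison
open Limits Opposite

variable {R : Type u} [CommRing R]

abbrev NExt (X Y : ModuleCat.{u} R) (n : ℕ) := CategoryTheory.Abelian.Ext.{u} X Y n
abbrev OExt (X Y : ModuleCat.{u} R) (n : ℕ) : ModuleCat.{u} R :=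
  ((Ext R (ModuleCat.{u} R) n).obj (op X)).obj Y

abbrev yF (Y : ModuleCat.{u} R) : ModuleCat.{u} R ⥤ (ModuleCat.{u} R)ᵒᵖ :=
  ((linearYoneda R (ModuleCat.{u} R)).obj Y).rightOp

abbrev yK {X : ModuleCat.{u} R} (P : ProjectiveResolution X) (Y : ModuleCat.{u} R) :
    ChainComplex (ModuleCat.{u} R)ᵒᵖ ℕ :=
  ((yF Y).mapHomologicalComplex (ComplexShape.down ℕ)).obj P.complex

def ldIso {X : ModuleCat.{u} R} (P : ProjectiveResolution X) (Y : ModuleCat.{u} R) (n : ℕ) :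
    ((yF Y).leftDerived n).obj X ≅ (yK P Y).homology n := P.isoLeftDerivedObj (yF Y) n

lemma ldIso_nat {X X' : ModuleCat.{u} R} (P : ProjectiveResolution X) (P' : ProjectiveResolution X')
    (Y : ModuleCat.{u} R) (n : ℕ) (g : X' ⟶ X) (φ : P'.complex ⟶ P.complex)
    (comm : φ.f 0 ≫ P.π.f 0 = P'.π.f 0 ≫ g) :
    ((yF Y).leftDerived n).map g ≫ (ldIso P Y n).hom = (ldIso P' Y n).hom ≫
      HomologicalComplex.homologyMap (((yF Y).mapHomologicalComplex (ComplexShape.down ℕ)).map φ) n :=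
  P'.isoLeftDerivedObj_hom_naturality g P φ comm (yF Y) n

def toOExt {X : ModuleCat.{u} R} (P : ProjectiveResolution X) (Y : ModuleCat.{u} R) (n : ℕ) :
    ((yK P Y).opcycles n).unop ⟶ OExt X Y n :=
  ((ldIso P Y n).hom ≫ (yK P Y).homologyι n).unop

def toHom {X : ModuleCat.{u} R} (P : ProjectiveResolution X) (Y : ModuleCat.{u} R) (n : ℕ) :
    ((yK P Y).opcycles n).unop ⟶ ModuleCat.of R (P.complex.X n ⟶ Y) :=
  ((yK P Y).pOpcycles n).unop

lemma toOExt_surj {X : ModuleCat.{u} R} (P : ProjectiveResolution X) (Y : ModuleCat.{u} R) (n : ℕ) :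
    Function.Surjective (toOExt P Y n) := by
  rw [← ModuleCat.epi_iff_surjective]
  unfold toOExt
  exact unop_epi_of_mono _

lemma toHom_inj {X : ModuleCat.{u} R} (P : ProjectiveResolution X) (Y : ModuleCat.{u} R) (n : ℕ) :
    Function.Injective (toHom P Y n) := by
  rw [← ModuleCat.mono_iff_injective]
  unfold toHom
  exact unop_mono_of_epi _

lemma toHom_d {X : ModuleCat.{u} R} (P : ProjectiveResolution X) (Y : ModuleCat.{u} R) (n : ℕ)
    (z : ((yK P Y).opcycles n).unop) : P.complex.d (n+1) n ≫ (toHom P Y n z : P.complex.X n ⟶ Y) = 0 := by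
  have h := (yK P Y).d_pOpcycles (n+1) n
  have h2 := congrArg (fun f => f.unop z) h
  exact h2

lemma exists_toHom {X : ModuleCat.{u} R} (P : ProjectiveResolution X) (Y : ModuleCat.{u} R) (n : ℕ)
    (f : P.complex.X n ⟶ Y) (hf : P.complex.d (n+1) n ≫ f = 0) :
    ∃ z, toHom P Y n z = f := by
  have hex : (ShortComplex.mk ((yK P Y).d (n+1) n) ((yK P Y).pOpcycles n) ((yK P Y).d_pOpcycles (n+1) n)).Exact :=
    ShortComplex.exact_of_g_is_cokernel _ ((yK P Y).opcyclesIsCokernel (n+1) n (by simp))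
  have := hex.unop
  rw [ShortComplex.moduleCat_exact_iff] at this
  exact this f hf

lemma toOExt_zero {X : ModuleCat.{u} R} (P : ProjectiveResolution X) (Y : ModuleCat.{u} R)
    (z : ((yK P Y).opcycles 0).unop) : toOExt P Y 0 z = 0 ↔ toHom P Y 0 z = 0 := by
  have h1 : Function.Injective (toOExt P Y 0) := by
    rw [← ModuleCat.mono_iff_injective]
    unfold toOExt
    have : IsIso ((yK P Y).homologyι 0) := by
      have : (yK P Y).homologyι 0 = (ChainComplex.isoHomologyι₀ (yK P Y)).hom := rfl
      rw [this]; infer_instance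
    exact unop_mono_of_epi _
  rw [map_eq_zero_iff _ h1, map_eq_zero_iff _ (toHom_inj P Y 0)]

lemma toOExt_succ {X : ModuleCat.{u} R} (P : ProjectiveResolution X) (Y : ModuleCat.{u} R) (n : ℕ)
    (z : ((yK P Y).opcycles (n+1)).unop) :
    toOExt P Y (n+1) z = 0 ↔ ∃ g : P.complex.X n ⟶ Y, P.complex.d (n+1) n ≫ g = toHom P Y (n+1) z := by
  have hk := (yK P Y).homologyIsKernel (n+1) n (by simp)
  have hex : (ShortComplex.mk ((yK P Y).homologyι (n+1)) ((yK P Y).fromOpcycles (n+1) n) (by simp)).Exact :=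
    ShortComplex.exact_of_f_is_kernel _ hk
  have := hex.unop
  rw [ShortComplex.moduleCat_exact_iff] at this
  have hc := congrArg (fun f => f.unop) ((yK P Y).p_fromOpcycles (n+1) n)
  constructor
  · intro h
    have h' : ((yK P Y).homologyι (n+1)).unop z = 0 := by
      have hi : Function.Injective (ldIso P Y (n+1)).hom.unop := by
        rw [← ModuleCat.mono_iff_injective]; infer_instance
      apply hi
      rw [map_zero]
      exact h
    obtain ⟨g, hg⟩ := this z h'
    refine ⟨g, ?_⟩
    rw [← hg]
    exact (congrArg (fun f => f g) hc).symm
  · rintro ⟨g, hg⟩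
    have : z = ((yK P Y).fromOpcycles (n+1) n).unop g := by
      apply toHom_inj P Y (n+1)
      rw [← hg]
      exact (congrArg (fun f => f g) hc).symm
    rw [this]
    have h0 := congrArg (fun f => f.unop g) ((yK P Y).homologyι_comp_fromOpcycles (n+1) n)
    have h1 : ((yK P Y).homologyι (n+1)).unop (((yK P Y).fromOpcycles (n+1) n).unop g) = 0 := h0
    have : toOExt P Y (n+1) (((yK P Y).fromOpcycles (n+1) n).unop g) =
      (ldIso P Y (n+1)).hom.unop (((yK P Y).homologyι (n+1)).unop (((yK P Y).fromOpcycles (n+1) n).unop g)) := rfl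
    rw [this, h1, map_zero]; rfl

lemma extMk_zero_iff {X : ModuleCat.{u} R} (P : ProjectiveResolution X) (Y : ModuleCat.{u} R)
    (f : P.complex.X 0 ⟶ Y) (hf : P.complex.d 1 0 ≫ f = 0) : P.extMk f 1 rfl hf = 0 ↔ f = 0 := by
  constructor
  · intro h
    rw [← P.extEquivCohomologyClass.apply_eq_iff_eq,
      P.extEquivCohomologyClass_extMk, P.extEquivCohomologyClass_zero,
      CochainComplex.HomComplex.CohomologyClass.mk_eq_zero_iff,
      CochainComplex.HomComplex.Cocycle.toSingleMk_mem_coboundaries_iff _ _ _ _ _ 1 (by simp)] at h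
    obtain ⟨g, hg⟩ := h
    have hz : IsZero (P.cochainComplex.X 1) := P.cochainComplex.isZero_of_isStrictlyLE 0 1
    rw [hz.eq_of_src g 0, comp_zero] at hg
    rw [← cancel_epi (P.cochainComplexXIso (-(0:ℕ)) 0 rfl).hom]
    rw [← hg, comp_zero]
  · rintro rfl; simp

/-- the relation between old and new Ext -/
def ERel {X : ModuleCat.{u} R} (P : ProjectiveResolution X) (Y : ModuleCat.{u} R) (n : ℕ)
    (x : OExt X Y n) (e : NExt X Y n) : Prop :=
  ∃ z, toOExt P Y n z = x ∧ P.extMk (toHom P Y n z : P.complex.X n ⟶ Y) (n+1) rfl (toHom_d P Y n z) = e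

variable {X : ModuleCat.{u} R} (P : ProjectiveResolution X) (Y : ModuleCat.{u} R) (n : ℕ)

lemma ERel_left (x : OExt X Y n) : ∃ e, ERel P Y n x e := by
  obtain ⟨z, rfl⟩ := toOExt_surj P Y n x
  exact ⟨_, z, rfl, rfl⟩

lemma ERel_right (e : NExt X Y n) : ∃ x, ERel P Y n x e := by
  obtain ⟨f, hf, rfl⟩ := P.extMk_surjective e (n+1) rfl
  obtain ⟨z, rfl⟩ := exists_toHom P Y n f hf
  exact ⟨_, z, rfl, rfl⟩

lemma ERel_zero {x : OExt X Y n} {e : NExt X Y n} (h : ERel P Y n x e) : x = 0 ↔ e = 0 := by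
  obtain ⟨z, rfl, rfl⟩ := h
  cases n with
  | zero => rw [toOExt_zero, extMk_zero_iff]
  | succ n => rw [toOExt_succ, P.extMk_eq_zero_iff _ _ _ _ n rfl]

lemma ERel_map {X' : ModuleCat.{u} R} (P' : ProjectiveResolution X') (g : X' ⟶ X)
    {x : OExt X Y n} {e : NExt X Y n} (h : ERel P Y n x e) :
    ERel P' Y n (((Ext R (ModuleCat.{u} R) n).map g.op).app Y x)
      ((Abelian.Ext.mk₀ g).comp e (zero_add n)) := by
  obtain ⟨z, rfl, rfl⟩ := h
  let φ : ProjectiveResolution.Hom P' P g :=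
    ⟨ProjectiveResolution.lift g P' P, by
      have := HomologicalComplex.congr_hom (ProjectiveResolution.lift_commutes g P' P) 0
      exact this⟩
  rw [ProjectiveResolution.mk₀_comp_extMk _ _ _ _ φ]
  let Φ := ((yF Y).mapHomologicalComplex (ComplexShape.down ℕ)).map φ.hom
  refine ⟨(HomologicalComplex.opcyclesMap Φ n).unop z, ?_, ?_⟩
  · have h1 := ldIso_nat P P' Y n g φ.hom φ.hom_f_zero_comp_π_f_zero
    have h2 := HomologicalComplex.homologyι_naturality Φ n
    have h3 : ((yF Y).leftDerived n).map g ≫ ((ldIso P Y n).hom ≫ (yK P Y).homologyι n)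
       = ((ldIso P' Y n).hom ≫ (yK P' Y).homologyι n) ≫ HomologicalComplex.opcyclesMap Φ n := by
      rw [← Category.assoc, h1, Category.assoc, Category.assoc, h2]
    exact (congrArg (fun f => f.unop z) h3).symm
  · have h3 := HomologicalComplex.p_opcyclesMap Φ n
    have h4 := congrArg (fun f => f.unop z) h3
    congr 1

lemma OExt_nontrivial_iff : Nontrivial (OExt X Y n) ↔ Nontrivial (NExt X Y n) := by
  let P := projectiveResolution X
  constructor
  · intro h
    obtain ⟨x, hx⟩ := exists_ne (0 : OExt X Y n)
    obtain ⟨e, he⟩ := ERel_left P Y n x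
    exact ⟨e, 0, fun h0 => hx ((ERel_zero P Y n he).2 h0)⟩
  · intro h
    obtain ⟨e, hx⟩ := exists_ne (0 : NExt X Y n)
    obtain ⟨x, he⟩ := ERel_right P Y n e
    exact ⟨x, 0, fun h0 => hx ((ERel_zero P Y n he).1 h0)⟩

end Comparison

section Colim
open Limits Opposite

variable {R : Type u} [CommRing R]

def trHom (a : Ideal R) {n m : ℕ} (h : n ≤ m) :
    ModuleCat.of R (R ⧸ a ^ m) ⟶ ModuleCat.of R (R ⧸ a ^ n) :=
  ModuleCat.ofHom (Submodule.mapQ (a ^ m) (a ^ n) LinearMap.id (Ideal.pow_le_pow_right h))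

/-- vanishing of local cohomology -/
def LCv (a : Ideal R) (i : ℕ) (Y : ModuleCat.{u} R) : Prop :=
  ∀ (n : ℕ) (e : NExt (ModuleCat.of R (R ⧸ a ^ n)) Y i), ∃ (m : ℕ) (h : n ≤ m),
    (Abelian.Ext.mk₀ (trHom a h)).comp e (zero_add i) = 0

lemma subsingleton_LC_iff (a : Ideal R) (i : ℕ) (Y : ModuleCat.{u} R) :
    Subsingleton ((localCohomology a i).obj Y) ↔ LCv a i Y := by
  let D := localCohomology.diagram (localCohomology.idealPowersDiagram a) i
  let G : ℕᵒᵖᵒᵖ ⥤ ModuleCat.{u} R := D ⋙ (evaluation _ _).obj Y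
  let iso : (localCohomology a i).obj Y ≅ colimit G := colimitObjIsoColimitCompEvaluation D Y
  have hs : Subsingleton ((localCohomology a i).obj Y) ↔ Subsingleton (colimit G :) :=
    iso.toLinearEquiv.toEquiv.subsingleton_congr
  rw [hs]
  have : PreservesFilteredColimitsOfSize.{0, 0} (forget (ModuleCat.{u} R)) :=
    preservesSmallestFilteredColimits_of_preservesFilteredColimits.{u, u} _
  have : PreservesColimit G (forget (ModuleCat.{u} R)) := inferInstance
  have hsub : Subsingleton (colimit G :) ↔ ∀ (n : ℕ) (x : G.obj (op (op n))),
      ∃ (m : ℕ) (h : n ≤ m), G.map (homOfLE h).op.op x = 0 := by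
    constructor
    · intro hsub n x
      obtain ⟨k, f, g, hf⟩ := (Concrete.colimit_rep_eq_iff_exists G x (0 : G.obj (op (op n)))).1 (Subsingleton.elim _ _)
      refine ⟨k.unop.unop, leOfHom f.unop.unop, ?_⟩
      have h1 : f = (homOfLE (leOfHom f.unop.unop)).op.op := rfl
      have h2 : G.map f x = 0 := hf.trans (map_zero (G.map g).hom)
      exact h2
    · intro h
      refine subsingleton_of_forall_eq 0 fun y => ?_
      obtain ⟨j, x, rfl⟩ := Concrete.colimit_exists_rep G y
      obtain ⟨m, hm, h0⟩ := h j.unop.unop x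
      rw [← colimit.w G (homOfLE hm).op.op, ModuleCat.comp_apply]
      exact (congrArg _ h0).trans (map_zero (colimit.ι G _).hom)
  rw [hsub]
  have key : ∀ {n m : ℕ} (h : n ≤ m) {x} {e} (he : ERel (projectiveResolution (ModuleCat.of R (R ⧸ a ^ n))) Y i x e),
      (G.map (homOfLE h).op.op x = 0 ↔ (Abelian.Ext.mk₀ (trHom a h)).comp e (zero_add i) = 0) := by
    intro n m h x e he
    exact ERel_zero _ _ _ (ERel_map _ Y i (projectiveResolution (ModuleCat.of R (R ⧸ a ^ m))) (trHom a h) he)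
  constructor
  · intro h n e
    obtain ⟨x, hx⟩ := ERel_right (projectiveResolution _) Y i e
    obtain ⟨m, hm, h0⟩ := h n x
    exact ⟨m, hm, (key hm hx).1 h0⟩
  · intro h n x
    obtain ⟨e, hx⟩ := ERel_left (projectiveResolution (ModuleCat.of R (R ⧸ a ^ n))) Y i x
    obtain ⟨m, hm, h0⟩ := h n e
    exact ⟨m, hm, (key hm hx).2 h0⟩
end Colim

section LES
variable {R : Type u} [CommRing R]
open Abelian

def pull (a : Ideal R) {n m : ℕ} (h : n ≤ m) {Y : ModuleCat.{u} R} {i : ℕ}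
    (e : NExt (ModuleCat.of R (R ⧸ a ^ n)) Y i) : NExt (ModuleCat.of R (R ⧸ a ^ m)) Y i :=
  (Abelian.Ext.mk₀ (trHom a h)).comp e (zero_add i)

lemma trHom_comp (a : Ideal R) {n m k : ℕ} (h : n ≤ m) (h' : m ≤ k) :
    trHom a h' ≫ trHom a h = trHom a (h.trans h') := by
  ext
  rfl

lemma pull_pull (a : Ideal R) {n m k : ℕ} (h : n ≤ m) (h' : m ≤ k) {Y : ModuleCat.{u} R} {i : ℕ}
    (e : NExt (ModuleCat.of R (R ⧸ a ^ n)) Y i) :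
    pull a h' (pull a h e) = pull a (h.trans h') e := by
  unfold pull
  rw [Ext.mk₀_comp_mk₀_assoc, trHom_comp]

lemma pull_comp (a : Ideal R) {n m : ℕ} (h : n ≤ m) {Y Z : ModuleCat.{u} R} {i j k : ℕ}
    (e : NExt (ModuleCat.of R (R ⧸ a ^ n)) Y i) (f : NExt Y Z j) (hk : i + j = k) :
    pull a h (e.comp f hk) = (pull a h e).comp f hk := by
  unfold pull
  rw [Ext.comp_assoc]
  omega

lemma pull_zero (a : Ideal R) {n m : ℕ} (h : n ≤ m) {Y : ModuleCat.{u} R} {i : ℕ} :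
    pull a h (0 : NExt (ModuleCat.of R (R ⧸ a ^ n)) Y i) = 0 := by
  simp [pull]

lemma LCv_iff (a : Ideal R) (i : ℕ) (Y : ModuleCat.{u} R) : LCv a i Y ↔
  ∀ (n : ℕ) (e : NExt (ModuleCat.of R (R ⧸ a ^ n)) Y i), ∃ (m : ℕ) (h : n ≤ m),
    pull a h e = 0 := Iff.rfl

variable {S : ShortComplex (ModuleCat.{u} R)}

lemma LCv_mid (hS : S.ShortExact) (a : Ideal R) (i : ℕ) (h1 : LCv a i S.X₁) (h3 : LCv a i S.X₃) : LCv a i S.X₂ := by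
  intro n e
  obtain ⟨m, hm, h0⟩ := h3 n (e.comp (Ext.mk₀ S.g) (add_zero i))
  obtain ⟨e1, he1⟩ := Ext.covariant_sequence_exact₂ _ hS (pull a hm e) (by
    rw [← pull_comp]; exact h0)
  obtain ⟨k, hk, h0'⟩ := h1 m e1
  refine ⟨k, hm.trans hk, ?_⟩
  change pull a _ e = 0
  rw [← pull_pull a hm hk, ← he1, pull_comp]
  change Ext.comp ((Abelian.Ext.mk₀ (trHom a hk)).comp e1 (zero_add i)) _ _ = 0
  rw [h0', Ext.zero_comp]

lemma LCv_left (hS : S.ShortExact) (a : Ideal R) (i : ℕ) (h1 : LCv a (i + 1) S.X₂) (h3 : LCv a i S.X₃) : LCv a (i + 1) S.X₁ := by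
  intro n e
  obtain ⟨m, hm, h0⟩ := h1 n (e.comp (Ext.mk₀ S.f) (add_zero _))
  obtain ⟨e1, he1⟩ := Ext.covariant_sequence_exact₁ _ hS (pull a hm e) (by
    rw [← pull_comp]; exact h0) rfl
  obtain ⟨k, hk, h0'⟩ := h3 m e1
  refine ⟨k, hm.trans hk, ?_⟩
  change pull a _ e = 0
  rw [← pull_pull a hm hk, ← he1, pull_comp]
  change Ext.comp ((Abelian.Ext.mk₀ (trHom a hk)).comp e1 (zero_add i)) _ _ = 0
  rw [h0', Ext.zero_comp]

lemma LCv_right (hS : S.ShortExact) (a : Ideal R) (i : ℕ) (h1 : LCv a (i + 1) S.X₁) (h3 : LCv a i S.X₂) : LCv a i S.X₃ := by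
  intro n e
  obtain ⟨m, hm, h0⟩ := h1 n (e.comp hS.extClass rfl)
  obtain ⟨e1, he1⟩ := Ext.covariant_sequence_exact₃ _ hS (pull a hm e) rfl (by
    rw [← pull_comp]; exact h0)
  obtain ⟨k, hk, h0'⟩ := h3 m e1
  refine ⟨k, hm.trans hk, ?_⟩
  change pull a _ e = 0
  rw [← pull_pull a hm hk, ← he1, pull_comp]
  change Ext.comp ((Abelian.Ext.mk₀ (trHom a hk)).comp e1 (zero_add i)) _ _ = 0
  rw [h0', Ext.zero_comp]

/-- unbundled version -/
def van (a : Ideal R) (i : ℕ) (N : Type u) [AddCommGroup N] [Module R N] : Prop :=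
  LCv a i (ModuleCat.of R N)

variable {A B C : Type u} [AddCommGroup A] [Module R A] [AddCommGroup B] [Module R B]
  [AddCommGroup C] [Module R C]

abbrev sesC (f : A →ₗ[R] B) (g : B →ₗ[R] C) (h : Function.Exact f g) : ShortComplex (ModuleCat.{u} R) :=
  ShortComplex.mk (ModuleCat.ofHom f) (ModuleCat.ofHom g) (by
    ext x; exact h.apply_apply_eq_zero x)

lemma sesC_exact (f : A →ₗ[R] B) (g : B →ₗ[R] C) (h : Function.Exact f g)
    (hf : Function.Injective f) (hg : Function.Surjective g) : (sesC f g h).ShortExact where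
  exact := (ShortComplex.ShortExact.moduleCat_exact_iff_function_exact _).2 h
  mono_f := (ModuleCat.mono_iff_injective _).2 hf
  epi_g := (ModuleCat.epi_iff_surjective _).2 hg


lemma van_mid (f : A →ₗ[R] B) (g : B →ₗ[R] C) (h : Function.Exact f g)
    (hf : Function.Injective f) (hg : Function.Surjective g) {a : Ideal R} {i : ℕ} (h1 : van a i A) (h3 : van a i C) : van a i B :=
  LCv_mid (sesC_exact f g h hf hg) a i h1 h3
lemma van_left (f : A →ₗ[R] B) (g : B →ₗ[R] C) (h : Function.Exact f g)
    (hf : Function.Injective f) (hg : Function.Surjective g) {a : Ideal R} {i : ℕ} (h1 : van a (i+1) B) (h3 : van a i C) : van a (i+1) A :=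
  LCv_left (sesC_exact f g h hf hg) a i h1 h3
lemma van_right (f : A →ₗ[R] B) (g : B →ₗ[R] C) (h : Function.Exact f g)
    (hf : Function.Injective f) (hg : Function.Surjective g) {a : Ideal R} {i : ℕ} (h1 : van a (i+1) A) (h3 : van a i B) : van a i C :=
  LCv_right (sesC_exact f g h hf hg) a i h1 h3

lemma van_retract {a : Ideal R} {i : ℕ} (f : A →ₗ[R] B) (g : B →ₗ[R] A) (h : ∀ x, g (f x) = x)
    (hB : van a i B) : van a i A := by
  intro n e
  obtain ⟨m, hm, h0⟩ := hB n (e.comp (Ext.mk₀ (ModuleCat.ofHom f)) (add_zero i))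
  refine ⟨m, hm, ?_⟩
  change pull a hm _ = 0 at h0
  change pull a hm e = 0
  rw [pull_comp] at h0
  have h2 : Ext.comp (Ext.comp (pull a hm e) (Ext.mk₀ (ModuleCat.ofHom f)) (add_zero i)) (Ext.mk₀ (ModuleCat.ofHom g)) (add_zero i) = 0 := by
    rw [h0, Ext.zero_comp]
  rw [Ext.comp_assoc_of_third_deg_zero, Ext.mk₀_comp_mk₀] at h2
  rw [show ModuleCat.ofHom f ≫ ModuleCat.ofHom g = 𝟙 (ModuleCat.of R A) by ext x; exact h x, Ext.comp_mk₀_id] at h2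
  exact h2

lemma van_equiv {a : Ideal R} {i : ℕ} (e : A ≃ₗ[R] B) (hB : van a i B) : van a i A :=
  van_retract e.toLinearMap e.symm.toLinearMap (by simp) hB

lemma van_subsingleton {a : Ideal R} {i : ℕ} [Subsingleton A] : van a i A := by
  intro n e
  refine ⟨n, le_rfl, ?_⟩
  have h1 : e = e.comp (Ext.mk₀ (𝟙 (ModuleCat.of R A))) (add_zero i) := by rw [Ext.comp_mk₀_id]
  rw [h1, show 𝟙 (ModuleCat.of R A) = 0 by ext x; exact Subsingleton.elim (α := A) _ _]
  simp

lemma ext_zero_of_bij {X Y : ModuleCat.{u} R} {r : R} (hX : ∀ x : X, r • x = 0)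
    (hY : Function.Bijective (fun y : Y => r • y)) {i : ℕ} (e : NExt X Y i) : e = 0 := by
  let φ : Y ≃ₗ[R] Y := LinearEquiv.ofBijective (LinearMap.lsmul R Y r) hY
  have h1 : r • e = 0 := by
    have : r • 𝟙 X = 0 := by ext x; exact hX x
    have h2 : r • e = (Ext.mk₀ (r • 𝟙 X)).comp e (zero_add i) := by
      rw [Ext.mk₀_smul, Ext.smul_comp, Ext.mk₀_id_comp]
    rw [h2, this]; simp
  have h2 : (r • e).comp (Ext.mk₀ (ModuleCat.ofHom φ.symm.toLinearMap)) (add_zero i) = e := by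
    rw [Ext.smul_eq_comp_mk₀, Ext.comp_assoc_of_third_deg_zero, Ext.mk₀_comp_mk₀]
    rw [show (r • 𝟙 Y) ≫ ModuleCat.ofHom φ.symm.toLinearMap = 𝟙 Y by
      ext x; exact φ.symm_apply_apply x, Ext.comp_mk₀_id]
  rw [← h2, h1, Ext.zero_comp]

lemma van_of_bij {a : Ideal R} {x : R} (hx : x ∈ a) (hY : Function.Bijective (fun y : A => x • y)) (i : ℕ) :
    van a i A := by
  intro n e
  refine ⟨n, le_rfl, ?_⟩
  rw [ext_zero_of_bij (r := x ^ n) ?_ ?_ e]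
  · simp
  · intro y
    obtain ⟨y, rfl⟩ := Ideal.Quotient.mk_surjective y
    change Ideal.Quotient.mk (a ^ n) (x ^ n * y) = 0
    exact Ideal.Quotient.eq_zero_iff_mem.2 (Ideal.mul_mem_right _ _ (Ideal.pow_mem_pow hx n))
  · change Function.Bijective (fun y : A => x ^ n • y)
    have : (fun y : A => x ^ n • y) = (fun y : A => x • y)^[n] := by
      ext y; simp
    rw [this]; exact hY.iterate n

/-- homs from cyclic module -/
def cyc {a : Ideal R} (n : ℕ) (c : C) (hc : ∀ r ∈ a ^ n, r • c = 0) :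
    ModuleCat.of R (R ⧸ a ^ n) ⟶ ModuleCat.of R C :=
  ModuleCat.ofHom (Submodule.liftQ (a ^ n) (LinearMap.toSpanSingleton R C c) (fun r hr => hc r hr))

lemma cyc_one {a : Ideal R} (n : ℕ) (c : C) (hc : ∀ r ∈ a ^ n, r • c = 0) :
    (cyc n c hc).hom (Ideal.Quotient.mk _ 1) = c := one_smul R c

lemma cyc_ext {I : Ideal R} {φ ψ : ModuleCat.of R (R ⧸ I) ⟶ ModuleCat.of R C}
    (h : φ.hom (Ideal.Quotient.mk _ 1) = ψ.hom (Ideal.Quotient.mk _ 1)) : φ = ψ := by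
  apply ModuleCat.hom_ext
  apply LinearMap.ext
  intro x
  obtain ⟨y, rfl⟩ := Ideal.Quotient.mk_surjective x
  have : (Ideal.Quotient.mk I y) = y • (Ideal.Quotient.mk I 1) := by
    change _ = Ideal.Quotient.mk I (y * 1)
    rw [mul_one]
  have h1 := φ.hom.map_smul y (Ideal.Quotient.mk I 1)
  have h2 := ψ.hom.map_smul y (Ideal.Quotient.mk I 1)
  rw [← this] at h1 h2
  exact h1.trans ((congrArg _ h).trans h2.symm)

lemma cyc_tors {I : Ideal R} (φ : ModuleCat.of R (R ⧸ I) ⟶ ModuleCat.of R C) (r : R) (hr : r ∈ I) :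
    r • φ.hom (Ideal.Quotient.mk _ 1) = 0 := by
  rw [← φ.hom.map_smul]
  have : r • (Ideal.Quotient.mk I 1) = 0 := by
    change Ideal.Quotient.mk I (r * 1) = 0
    rw [mul_one]; exact Ideal.Quotient.eq_zero_iff_mem.2 hr
  exact (congrArg _ this).trans (map_zero φ.hom)

lemma van_zero_iff {a : Ideal R} : van a 0 C ↔ ∀ (n : ℕ) (c : C), (∀ r ∈ a ^ n, r • c = 0) → c = 0 := by
  constructor
  · intro hv n c hc
    obtain ⟨m, hm, h0⟩ := hv n (Ext.mk₀ (cyc n c hc))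
    rw [Ext.mk₀_comp_mk₀, Ext.mk₀_eq_zero_iff] at h0
    have := congrArg (fun φ => φ.hom (Ideal.Quotient.mk (a ^ m) 1)) h0
    exact (cyc_one n c hc).symm.trans this
  · intro hv n e
    obtain ⟨φ, rfl⟩ := Ext.mk₀_bijective _ _ |>.2 e
    refine ⟨n, le_rfl, ?_⟩
    rw [show φ = 0 from cyc_ext (hv n _ (cyc_tors φ))]
    simp

lemma van_one_iff (f : A →ₗ[R] B) (g : B →ₗ[R] C) (h : Function.Exact f g)
    (hf : Function.Injective f) (hg : Function.Surjective g) {a : Ideal R} (hB : van a 1 B) : van a 1 A ↔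
    ∀ (n : ℕ) (c : C), (∀ r ∈ a ^ n, r • c = 0) → ∃ (m : ℕ) (b : B), (∀ r ∈ a ^ m, r • b = 0) ∧ g b = c := by
  have hS := sesC_exact f g h hf hg
  constructor
  · intro hA n c hc
    let φ : NExt (ModuleCat.of R (R ⧸ a ^ n)) (sesC f g h).X₃ 0 := Ext.mk₀ (cyc n c hc)
    obtain ⟨m, hm, h0⟩ := hA n (φ.comp hS.extClass (zero_add 1))
    change pull a hm _ = 0 at h0
    rw [pull_comp] at h0
    obtain ⟨e, he⟩ := Ext.covariant_sequence_exact₃ _ hS _ _ h0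
    obtain ⟨ψ, rfl⟩ := Ext.mk₀_bijective _ _ |>.2 e
    have he' : pull a hm φ = Ext.mk₀ (trHom a hm ≫ cyc n c hc) := Ext.mk₀_comp_mk₀ _ _
    rw [Ext.mk₀_comp_mk₀, he'] at he
    have := (Ext.mk₀_bijective _ _).1 he
    refine ⟨m, ψ.hom (Ideal.Quotient.mk _ 1), cyc_tors (C := B) ψ, ?_⟩
    have := congrArg (fun φ => φ.hom (Ideal.Quotient.mk (a ^ m) 1)) this
    exact this.trans (cyc_one n c hc)
  · intro hC n e
    obtain ⟨m, hm, h0⟩ := hB n (e.comp (Ext.mk₀ (sesC f g h).f) (add_zero 1))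
    change pull a hm _ = 0 at h0
    rw [pull_comp] at h0
    obtain ⟨e1, he1⟩ := Ext.covariant_sequence_exact₁ _ hS _ h0 (zero_add 1)
    obtain ⟨φ, rfl⟩ := Ext.mk₀_bijective _ _ |>.2 e1
    obtain ⟨k, b, hb, hbc⟩ := hC m _ (cyc_tors (C := C) φ)
    have hkm : m ≤ max k m := le_max_right _ _
    refine ⟨max k m, hm.trans hkm, ?_⟩
    change pull a _ e = 0
    have hb' : ∀ r ∈ a ^ (max k m), r • b = 0 := fun r hr => hb r (Ideal.pow_le_pow_right (le_max_left _ _) hr)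
    have h3 : pull a hkm (Ext.mk₀ φ) = (Ext.mk₀ (cyc (max k m) b hb')).comp (Ext.mk₀ (sesC f g h).g) (add_zero 0) := by
      rw [Ext.mk₀_comp_mk₀]
      refine (Ext.mk₀_comp_mk₀ _ _).trans ?_
      congr 1
      apply cyc_ext (C := C)
      have : g ((cyc (max k m) b hb').hom (Ideal.Quotient.mk _ 1)) = g b := by rw [cyc_one]
      exact (this.trans hbc).symm
    rw [← pull_pull a hm hkm, ← he1, pull_comp, h3, Ext.comp_assoc_of_second_deg_zero,
      hS.comp_extClass, Ext.comp_zero]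
end LES

section Gam
variable {R : Type u} [CommRing R]
open Abelian

def Gam (a : Ideal R) (E : Type u) [AddCommGroup E] [Module R E] : Submodule R E where
  carrier := {y | ∃ n : ℕ, ∀ r ∈ a ^ n, r • y = 0}
  zero_mem' := ⟨0, by simp⟩
  add_mem' := by
    rintro x y ⟨n, hn⟩ ⟨m, hm⟩
    refine ⟨n + m, fun r hr => ?_⟩
    rw [smul_add, hn r (Ideal.pow_le_pow_right (by omega) hr),
      hm r (Ideal.pow_le_pow_right (by omega) hr), add_zero]
  smul_mem' := by
    rintro c x ⟨n, hn⟩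
    exact ⟨n, fun r hr => by rw [smul_comm, hn r hr, smul_zero]⟩

lemma Gam_injective [IsNoetherianRing R] (a : Ideal R) (E : Type u) [AddCommGroup E] [Module R E]
    (hE : Module.Injective R E) : Module.Injective R (Gam a E) := by
  apply Module.Baer.injective
  intro I g
  have hk : ∃ k : ℕ, ∀ r ∈ a ^ k, ∀ x : I, r • (g x : E) = 0 := by
    have hfg : (⊤ : Submodule R I).FG := Module.Finite.fg_top
    obtain ⟨s, hs⟩ := hfg
    choose k hk using fun x : I => (g x).2
    refine ⟨s.sup k, fun r hr x => ?_⟩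
    have hx : x ∈ Submodule.span R (s : Set I) := hs ▸ Submodule.mem_top
    induction hx using Submodule.span_induction with
    | mem x hx => exact hk x r (Ideal.pow_le_pow_right (Finset.le_sup hx) hr)
    | zero => simp
    | add x y _ _ h1 h2 => simp [smul_add, h1, h2]
    | smul c x _ h1 => rw [map_smul, Submodule.coe_smul, smul_comm, h1, smul_zero]
  obtain ⟨k, hk⟩ := hk
  obtain ⟨k0, hk0⟩ := Ideal.exists_pow_inf_eq_pow_smul (M := R) a I
  let J : Ideal R := a ^ (k + k0)
  have hJ : ∀ x (hx : x ∈ I), x ∈ J → (g ⟨x, hx⟩ : E) = 0 := by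
    intro x hx hxJ
    have h1 : x ∈ a ^ (k + k0) • (⊤ : Submodule R R) ⊓ I := ⟨by simpa using hxJ, hx⟩
    rw [hk0 _ (by omega)] at h1
    have h2 : x ∈ a ^ k • I := by
      rw [show k + k0 - k0 = k by omega] at h1
      exact Submodule.smul_mono le_rfl inf_le_right h1
    have : ∃ hx : x ∈ I, (g ⟨x, hx⟩ : E) = 0 := by
      refine Submodule.smul_induction_on h2 ?_ ?_
      · intro r hr n hn
        refine ⟨I.smul_mem r hn, ?_⟩
        have := g.map_smul r ⟨n, hn⟩
        have h3 : (⟨r • n, I.smul_mem r hn⟩ : I) = r • ⟨n, hn⟩ := rfl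
        rw [h3, this]
        exact hk r hr _
      · rintro x y ⟨hx, h1⟩ ⟨hy, h2⟩
        refine ⟨I.add_mem hx hy, ?_⟩
        have h3 : (⟨x + y, I.add_mem hx hy⟩ : I) = ⟨x, hx⟩ + ⟨y, hy⟩ := rfl
        rw [h3, map_add, Submodule.coe_add, h1, h2, add_zero]
    exact this.2
  let p1 : R →ₗ.[R] E := ⟨I, (Gam a E).subtype ∘ₗ g⟩
  let p2 : R →ₗ.[R] E := ⟨J, 0⟩
  have H : ∀ (x : p1.domain) (y : p2.domain), (x : R) = y → p1 x = p2 y := by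
    rintro ⟨x, hx⟩ ⟨y, hy⟩ hxy
    change x = y at hxy
    subst hxy
    exact hJ x hx hy
  let p := p1.sup p2 H
  obtain ⟨ψ, hψ⟩ := Module.Baer.of_injective hE p.domain p.toFun
  have hψ1 : ∀ x (hx : x ∈ I), ψ x = g ⟨x, hx⟩ := by
    intro x hx
    rw [hψ x ((le_sup_left : I ≤ I ⊔ J) hx)]
    have := LinearPMap.sup_apply H ⟨x, hx⟩ 0 ⟨x, (le_sup_left : I ≤ I ⊔ J) hx⟩ (by simp)
    exact this.trans (by rw [LinearPMap.map_zero, add_zero]; rfl)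
  have hψ2 : ∀ x (hx : x ∈ J), ψ x = 0 := by
    intro x hx
    rw [hψ x ((le_sup_right : J ≤ I ⊔ J) hx)]
    have := LinearPMap.sup_apply H 0 ⟨x, hx⟩ ⟨x, (le_sup_right : J ≤ I ⊔ J) hx⟩ (by simp)
    exact this.trans (by rw [LinearPMap.map_zero, zero_add]; rfl)
  have h1 : ψ 1 ∈ Gam a E := ⟨k + k0, fun r hr => by
    rw [← map_smul, smul_eq_mul, mul_one]; exact hψ2 r hr⟩
  refine ⟨LinearMap.toSpanSingleton R _ ⟨ψ 1, h1⟩, fun x hx => ?_⟩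
  apply Subtype.ext
  rw [← hψ1 x hx]
  change x • ψ 1 = ψ x
  rw [← map_smul, smul_eq_mul, mul_one]

lemma van_injective (a : Ideal R) (E : Type u) [AddCommGroup E] [Module R E]
    (hE : Module.Injective R E) (i : ℕ) : van a (i + 1) E := by
  intro n e
  have : Injective (ModuleCat.of R E) := Module.injective_object_of_injective_module R E
  exact ⟨n, le_rfl, by rw [Ext.eq_zero_of_injective e]; simp⟩

lemma exists_emb (N : Type u) [AddCommGroup N] [Module R N] :
    ∃ (E : Type u) (_ : AddCommGroup E) (_ : Module R E) (f : N →ₗ[R] E),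
      Module.Injective R E ∧ Function.Injective f := by
  let E := Injective.under (ModuleCat.of R N)
  let ι := Injective.ι (ModuleCat.of R N)
  have h : Injective (ModuleCat.of R E) := inferInstanceAs (Injective E)
  exact ⟨E, inferInstance, inferInstance, ι.hom,
    Module.injective_module_of_injective_object R E, (ModuleCat.mono_iff_injective ι).1 inferInstance⟩

/-- quotient SES -/
lemma exact_sub {B : Type u} [AddCommGroup B] [Module R B] (p : Submodule R B) :
    Function.Exact p.subtype p.mkQ := by
  intro x; simp

lemma exact_rangeQ {A B : Type u} [AddCommGroup A] [Module R A] [AddCommGroup B] [Module R B] (f : A →ₗ[R] B) :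
    Function.Exact f (LinearMap.range f).mkQ := by
  intro x; simp

def IsTors (a : Ideal R) (N : Type u) [AddCommGroup N] [Module R N] : Prop :=
  ∀ y : N, ∃ n : ℕ, ∀ r ∈ a ^ n, r • y = 0

lemma van_tors [IsNoetherianRing R] (a : Ideal R) (i : ℕ) : ∀ (N : Type u) [AddCommGroup N] [Module R N],
    IsTors a N → van a (i + 1) N := by
  induction i with
  | zero =>
    intro N _ _ hN
    obtain ⟨E, _, _, f, hE, hf⟩ := exists_emb (R := R) N
    let f' : N →ₗ[R] Gam a E := f.codRestrict _ (fun y => by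
      obtain ⟨n, hn⟩ := hN y
      exact ⟨n, fun r hr => by rw [← map_smul, hn r hr, map_zero]⟩)
    have hf' : Function.Injective f' := fun x y hxy => hf (congrArg Subtype.val hxy)
    refine (van_one_iff f' _ (exact_rangeQ f') hf' (Submodule.mkQ_surjective _)
      (van_injective a _ (Gam_injective a E hE) 0)).2 ?_
    intro n c hc
    obtain ⟨b, rfl⟩ := Submodule.mkQ_surjective _ c
    obtain ⟨m, hm⟩ := b.2
    exact ⟨m, b, fun r hr => Subtype.ext (hm r hr), rfl⟩
  | succ i ih =>
    intro N _ _ hN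
    obtain ⟨E, _, _, f, hE, hf⟩ := exists_emb (R := R) N
    let f' : N →ₗ[R] Gam a E := f.codRestrict _ (fun y => by
      obtain ⟨n, hn⟩ := hN y
      exact ⟨n, fun r hr => by rw [← map_smul, hn r hr, map_zero]⟩)
    have hf' : Function.Injective f' := fun x y hxy => hf (congrArg Subtype.val hxy)
    refine van_left f' _ (exact_rangeQ f') hf' (Submodule.mkQ_surjective _)
      (van_injective a _ (Gam_injective a E hE) _) (ih _ ?_)
    intro c
    obtain ⟨b, rfl⟩ := Submodule.mkQ_surjective _ c
    obtain ⟨m, hm⟩ := b.2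
    refine ⟨m, fun r hr => ?_⟩
    rw [← map_smul, show r • b = 0 from Subtype.ext (hm r hr), map_zero]
end Gam

section CD
variable {R : Type u} [CommRing R]

def PT (s : Set R) (N : Type u) [AddCommGroup N] [Module R N] : Prop :=
  ∀ x ∈ s, ∀ y : N, ∃ n : ℕ, x ^ n • y = 0

lemma PT.isTors [IsNoetherianRing R] {s : Set R} {N : Type u} [AddCommGroup N] [Module R N]
    (h : PT s N) {a : Ideal R} (ha : a ≤ Ideal.span s) : IsTors a N := by
  intro y
  let I : Ideal R := LinearMap.ker (LinearMap.toSpanSingleton R N y)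
  have h1 : a ≤ I.radical := by
    refine ha.trans (Ideal.span_le.2 fun x hx => ?_)
    obtain ⟨n, hn⟩ := h x hx y
    exact ⟨n, hn⟩
  obtain ⟨n, hn⟩ := Ideal.exists_pow_le_of_le_radical_of_fg h1 (IsNoetherian.noetherian a)
  exact ⟨n, fun r hr => hn hr⟩

lemma mem_Gam_single {x : R} {N : Type u} [AddCommGroup N] [Module R N] {y : N} :
    y ∈ Gam (Ideal.span {x}) N ↔ ∃ n : ℕ, x ^ n • y = 0 := by
  constructor
  · rintro ⟨n, hn⟩
    exact ⟨n, hn _ (Ideal.pow_mem_pow (Ideal.mem_span_singleton_self x) n)⟩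
  · rintro ⟨n, hn⟩
    refine ⟨n, fun r hr => ?_⟩
    rw [Ideal.span_singleton_pow, Ideal.mem_span_singleton] at hr
    obtain ⟨c, rfl⟩ := hr
    rw [mul_comm, mul_smul, hn, smul_zero]

lemma van_list [IsNoetherianRing R] (a : Ideal R) (l : List R) : ∀ (s : Set R)
    (N : Type u) [AddCommGroup N] [Module R N], PT s N → (∀ x ∈ l, x ∈ a) →
    a ≤ Ideal.span (s ∪ {x | x ∈ l}) → ∀ i, l.length < i → van a i N := by
  induction l with
  | nil =>
    intro s N _ _ hN _ ha i hi
    obtain ⟨j, rfl⟩ : ∃ j, i = j + 1 := ⟨i - 1, by simp at hi; omega⟩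
    exact van_tors a j N (hN.isTors (by simpa using ha))
  | cons x l ih =>
    intro s N _ _ hN hl ha i hi
    obtain ⟨j, rfl⟩ : ∃ j, i = j + 1 := ⟨i - 1, by simp at hi; omega⟩
    have hj : l.length < j := by simpa using hi
    have ha' : a ≤ Ideal.span ((insert x s) ∪ {x | x ∈ l}) := by
      refine ha.trans (Ideal.span_mono ?_)
      rintro y (hy | hy)
      · exact Or.inl (Or.inr hy)
      · rcases List.mem_cons.1 hy with rfl | hy
        · exact Or.inl (Or.inl rfl)
        · exact Or.inr hy
    have hl' : ∀ x ∈ l, x ∈ a := fun y hy => hl y (List.mem_cons_of_mem _ hy)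
    have hx : x ∈ a := hl x List.mem_cons_self
    let G := Gam (Ideal.span {x}) N
    let Q := N ⧸ G
    have hG : PT (insert x s) G := by
      rintro z (rfl | hz) y
      · obtain ⟨n, hn⟩ := mem_Gam_single.1 y.2
        exact ⟨n, Subtype.ext hn⟩
      · obtain ⟨n, hn⟩ := hN z hz y
        exact ⟨n, Subtype.ext hn⟩
    have hQs : PT s Q := by
      intro z hz y
      obtain ⟨y, rfl⟩ := G.mkQ_surjective y
      obtain ⟨n, hn⟩ := hN z hz y
      exact ⟨n, by rw [← map_smul, hn, map_zero]⟩
    have hQx : ∀ y : Q, ∀ n : ℕ, x ^ n • y = 0 → y = 0 := by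
      intro y n hy
      obtain ⟨y, rfl⟩ := G.mkQ_surjective y
      rw [← map_smul, Submodule.mkQ_apply, Submodule.Quotient.mk_eq_zero] at hy
      obtain ⟨m, hm⟩ := mem_Gam_single.1 hy
      rw [Submodule.mkQ_apply, Submodule.Quotient.mk_eq_zero]
      exact mem_Gam_single.2 ⟨m + n, by rw [pow_add, mul_smul, hm]⟩
    let Qx := LocalizedModule (Submonoid.powers x) Q
    let f : Q →ₗ[R] Qx := LocalizedModule.mkLinearMap (Submonoid.powers x) Q
    have hf : Function.Injective f := by
      rw [injective_iff_map_eq_zero]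
      intro y hy
      obtain ⟨⟨_, n, rfl⟩, hc⟩ := (IsLocalizedModule.eq_zero_iff (Submonoid.powers x) f).1 hy
      exact hQx y n hc
    have hbij : ∀ t : Submonoid.powers x, Function.Bijective (fun y : Qx => (t : R) • y) := fun t =>
      (Module.End.isUnit_iff _).1 (IsLocalizedModule.map_units f t)
    have hW : PT (insert x s) (Qx ⧸ LinearMap.range f) := by
      intro z hz y
      obtain ⟨y, rfl⟩ := Submodule.mkQ_surjective _ y
      obtain ⟨⟨q, t⟩, hq⟩ := IsLocalizedModule.surj (Submonoid.powers x) f y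
      rcases hz with rfl | hz
      · obtain ⟨_, n, rfl⟩ := t
        refine ⟨n, ?_⟩
        rw [← map_smul, Submodule.mkQ_apply, Submodule.Quotient.mk_eq_zero]
        exact ⟨q, hq.symm⟩
      · obtain ⟨n, hn⟩ := hQs z hz q
        refine ⟨n, ?_⟩
        have : z ^ n • y = 0 := by
          apply (hbij t).1
          change (t : R) • z ^ n • y = (t : R) • (0 : Qx)
          rw [smul_comm, smul_zero]
          have hq' : (t : R) • y = f q := hq
          rw [hq', ← map_smul, hn, map_zero]
        rw [← map_smul, this, map_zero]
    have hvQ : van a (j + 1) Q :=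
      van_left f _ (exact_rangeQ f) hf (Submodule.mkQ_surjective _)
        (van_of_bij hx (hbij ⟨x, 1, by simp⟩) _) (ih _ _ hW hl' ha' j hj)
    exact van_mid G.subtype G.mkQ (exact_sub G) G.injective_subtype G.mkQ_surjective
      (ih _ _ hG hl' ha' _ (by omega)) hvQ

lemma exists_cd_bound [IsNoetherianRing R] (a : Ideal R) : ∃ r : ℕ, ∀ (N : Type u) [AddCommGroup N] [Module R N]
    (i : ℕ), r < i → van a i N := by
  obtain ⟨s, hs⟩ := IsNoetherian.noetherian a
  refine ⟨s.toList.length, fun N _ _ i hi => van_list a s.toList ∅ N (by intro x hx; cases hx) ?_ ?_ i hi⟩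
  · intro x hx
    rw [← hs]
    exact Submodule.subset_span (by simpa using hx)
  · rw [← hs]
    apply Ideal.span_mono
    intro x hx
    simpa using hx

variable {T : Type u} [CommRing T] [Algebra R T]

lemma van_Tinj [IsNoetherianRing R] [IsNoetherianRing T] (a : Ideal R) (l : List R) : ∀ (s : Set R)
    (E : Type u) [AddCommGroup E] [Module R E] [Module T E] [IsScalarTower R T E],
    Module.Injective T E → PT s E → (∀ x ∈ l, x ∈ a) →
    a ≤ Ideal.span (s ∪ {x | x ∈ l}) → ∀ i, van a (i + 1) E := by
  induction l with
  | nil =>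
    intro s N _ _ _ _ _ hN _ ha i
    exact van_tors a i N (hN.isTors (by simpa using ha))
  | cons x l ih =>
    intro s E _ _ _ _ hE hN hl ha i
    have ha' : a ≤ Ideal.span ((insert x s) ∪ {x | x ∈ l}) := by
      refine ha.trans (Ideal.span_mono ?_)
      rintro y (hy | hy)
      · exact Or.inl (Or.inr hy)
      · rcases List.mem_cons.1 hy with rfl | hy
        · exact Or.inl (Or.inl rfl)
        · exact Or.inr hy
    have hl' : ∀ x ∈ l, x ∈ a := fun y hy => hl y (List.mem_cons_of_mem _ hy)
    have hx : x ∈ a := hl x List.mem_cons_self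
    let x' : T := algebraMap R T x
    have hpow : ∀ (n : ℕ) (y : E), x' ^ n • y = x ^ n • y := fun n y => by
      rw [← map_pow, algebraMap_smul]
    let G : Submodule T E := Gam (Ideal.span {x'}) E
    have hGi : Module.Injective T G := Gam_injective _ E hE
    obtain ⟨π, hπ⟩ := hGi.out G.subtype G.injective_subtype LinearMap.id
    let Q := E ⧸ G
    let p : E →ₗ[T] E := LinearMap.id - G.subtype ∘ₗ π
    let j : Q →ₗ[T] E := G.liftQ p (fun y hy => by
      have := hπ ⟨y, hy⟩
      change y - (π y : E) = 0
      change π y = ⟨y, hy⟩ at this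
      rw [this, sub_self])
    have hj : ∀ q, G.mkQ (j q) = q := by
      intro q
      obtain ⟨y, rfl⟩ := G.mkQ_surjective q
      change G.mkQ (y - (π y : E)) = G.mkQ y
      rw [map_sub, sub_eq_self, Submodule.mkQ_apply, Submodule.Quotient.mk_eq_zero]
      exact (π y).2
    have hinj : Function.Injective (LinearMap.lsmul T Q x') := by
      rw [injective_iff_map_eq_zero]
      intro y hy
      obtain ⟨y, rfl⟩ := G.mkQ_surjective y
      rw [LinearMap.lsmul_apply, ← map_smul, Submodule.mkQ_apply, Submodule.Quotient.mk_eq_zero] at hy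
      obtain ⟨m, hm⟩ := mem_Gam_single.1 hy
      rw [Submodule.mkQ_apply, Submodule.Quotient.mk_eq_zero]
      exact mem_Gam_single.2 ⟨m + 1, by rw [pow_add, mul_smul, pow_one, hm]⟩
    obtain ⟨h, hh⟩ := hE.out (LinearMap.lsmul T Q x') hinj j
    have hsurj : Function.Surjective (LinearMap.lsmul T Q x') := by
      intro q
      refine ⟨G.mkQ (h q), ?_⟩
      rw [LinearMap.lsmul_apply, ← map_smul, ← map_smul]
      exact (congrArg _ (hh q)).trans (hj q)
    have hbij : Function.Bijective (fun y : Q => x • y) := by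
      have : (fun y : Q => x • y) = LinearMap.lsmul T Q x' := by
        ext y
        exact (algebraMap_smul T x y).symm
      rw [this]; exact ⟨hinj, hsurj⟩
    have hG : PT (insert x s) G := by
      rintro z (rfl | hz) y
      · obtain ⟨n, hn⟩ := mem_Gam_single.1 y.2
        exact ⟨n, Subtype.ext ((hpow n y).symm.trans hn)⟩
      · obtain ⟨n, hn⟩ := hN z hz y
        exact ⟨n, Subtype.ext hn⟩
    exact van_mid (G.subtype.restrictScalars R) (G.mkQ.restrictScalars R) (exact_sub G)
      G.injective_subtype G.mkQ_surjective (ih _ G hGi hG hl' ha' i) (van_of_bij hx hbij _)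

lemma van_Tinj' [IsNoetherianRing R] [IsNoetherianRing T] (a : Ideal R)
    (E : Type u) [AddCommGroup E] [Module R E] [Module T E] [IsScalarTower R T E]
    (hE : Module.Injective T E) (i : ℕ) : van a (i + 1) E := by
  obtain ⟨s, hs⟩ := IsNoetherian.noetherian a
  refine van_Tinj (T := T) a s.toList ∅ E hE (by intro x hx; cases hx) ?_ ?_ i
  · intro x hx
    rw [← hs]
    exact Submodule.subset_span (by simpa using hx)
  · rw [← hs]
    apply Ideal.span_mono
    intro x hx
    simpa using hx

/-- torsion comparison -/
lemma tors_iff (a : Ideal R) {E : Type u} [AddCommGroup E] [Module R E] [Module T E] [IsScalarTower R T E]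
    (n : ℕ) (y : E) : (∀ r ∈ (a.map (algebraMap R T)) ^ n, r • y = 0) ↔ ∀ r ∈ a ^ n, r • y = 0 := by
  rw [← Ideal.map_pow]
  constructor
  · intro h r hr
    rw [← algebraMap_smul T r y]
    exact h _ (Ideal.mem_map_of_mem _ hr)
  · intro h r hr
    have : Ideal.map (algebraMap R T) (a ^ n) ≤ LinearMap.ker (LinearMap.toSpanSingleton T E y) := by
      rw [Ideal.map_le_iff_le_comap]
      intro r hr
      change algebraMap R T r • y = 0
      rw [algebraMap_smul]; exact h r hr
    exact this hr

variable (R T) in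
lemma exists_embT (N : Type u) [AddCommGroup N] [Module T N] :
    ∃ (E : Type u) (_ : AddCommGroup E) (_ : Module R E) (_ : Module T E) (_ : IsScalarTower R T E) (f : N →ₗ[T] E),
      Module.Injective T E ∧ Function.Injective f := by
  obtain ⟨E, _, _, f, hE, hf⟩ := exists_emb (R := T) N
  let _ : Module R E := Module.compHom E (algebraMap R T)
  have : IsScalarTower R T E := ⟨fun r t y => by
        rw [Algebra.smul_def, mul_smul]; rfl⟩
  exact ⟨E, inferInstance, inferInstance, inferInstance, this, f, hE, hf⟩

lemma van_restrict_one [IsNoetherianRing R] [IsNoetherianRing T] (a : Ideal R)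
    (N : Type u) [AddCommGroup N] [Module R N] [Module T N] [IsScalarTower R T N]
    (hN : van (a.map (algebraMap R T)) 1 N) : van a 1 N := by
  obtain ⟨E, _, _, _, _, f, hE, hf⟩ := exists_embT R T N
  have hQ := exact_rangeQ f
  have hs := Submodule.mkQ_surjective (LinearMap.range f)
  generalize (LinearMap.range f).mkQ = g at hQ hs
  have h1 := (van_one_iff f g hQ hf hs (van_injective _ E hE 0)).1 hN
  refine (van_one_iff (f.restrictScalars R) (g.restrictScalars R) hQ hf hs (van_Tinj' (T := T) a E hE 0)).2 ?_
  intro n c hc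
  obtain ⟨m, b, hb, hbc⟩ := h1 n c ((tors_iff a n c).2 hc)
  exact ⟨m, b, (tors_iff a m b).1 hb, hbc⟩

lemma van_restrict_succ [IsNoetherianRing R] [IsNoetherianRing T] (a : Ideal R) (i : ℕ)
    (N : Type u) [AddCommGroup N] [Module R N] [Module T N] [IsScalarTower R T N]
    (hN : van (a.map (algebraMap R T)) (i + 1) N) : van a (i + 1) N := by
  induction i generalizing N with
  | zero => exact van_restrict_one a N hN
  | succ i ih =>
    obtain ⟨E, _, _, _, _, f, hE, hf⟩ := exists_embT R T N
    have hQ := exact_rangeQ f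
    have hs := Submodule.mkQ_surjective (LinearMap.range f)
    generalize (LinearMap.range f).mkQ = g at hQ hs
    have h1 := van_right f g hQ hf hs hN (van_injective _ E hE _)
    exact van_left (f.restrictScalars R) (g.restrictScalars R) hQ hf hs
      (van_Tinj' (T := T) a E hE _) (ih _ h1)

lemma van_restrict [IsNoetherianRing R] [IsNoetherianRing T] (a : Ideal R) (i : ℕ)
    (N : Type u) [AddCommGroup N] [Module R N] [Module T N] [IsScalarTower R T N]
    (hN : van (a.map (algebraMap R T)) i N) : van a i N := by
  cases i with
  | zero =>
    rw [van_zero_iff] at hN ⊢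
    intro n c hc
    exact hN n c ((tors_iff a n c).2 hc)
  | succ i => exact van_restrict_succ a i N hN
end CD

def IsPureAlgebra' (R T : Type u) [CommRing R] [CommRing T] [Algebra R T] : Prop :=
  ∀ (N : Type u) [AddCommGroup N] [Module R N],
    Function.Injective (fun n : N => (1 : T) ⊗ₜ[R] n)

section Pure
variable {R : Type u} [CommRing R] {T : Type u} [CommRing T] [Algebra R T]
open Abelian

lemma pure_ext_zero (hp : IsPureAlgebra' R T) {P N : Type u} [AddCommGroup P] [Module R P] [Module.Finite R P]
    [AddCommGroup N] [Module R N] {n : ℕ} (f : P →ₗ[R] (Fin n → R)) (g : P →ₗ[R] N)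
    (h : (Fin n → R) →ₗ[R] T ⊗[R] N) (hh : ∀ p, h (f p) = (1 : T) ⊗ₜ[R] g p) :
    ∃ h' : (Fin n → R) →ₗ[R] N, ∀ p, h' (f p) = g p := by
  classical
  obtain ⟨m, p, hspan⟩ := Module.Finite.exists_fin (R := R) (M := P)
  let A : (Fin n → N) →ₗ[R] (Fin m → N) :=
    LinearMap.pi fun k => ∑ j, f (p k) j • LinearMap.proj j
  let b : Fin m → N := fun k => g (p k)
  let C := (Fin m → N) ⧸ LinearMap.range A
  let q : (Fin m → N) →ₗ[R] C := (LinearMap.range A).mkQ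
  let σ : Fin m → (N →ₗ[R] C) := fun k => q ∘ₗ LinearMap.single R (fun _ => N) k
  have hσ : ∀ j, ∑ k, f (p k) j • σ k = 0 := by
    intro j
    ext y
    have : ∑ k, f (p k) j • σ k = q ∘ₗ ∑ k, f (p k) j • LinearMap.single R (fun _ => N) k := by
      ext z
      simp [σ]
    rw [this]
    have h2 : (∑ k, f (p k) j • LinearMap.single R (fun _ : Fin m => N) k) y = A (Pi.single j y) := by
      ext k
      simp [A, Finset.sum_apply, Pi.single_apply]
    rw [LinearMap.comp_apply, h2, LinearMap.zero_apply]
    exact (Submodule.Quotient.mk_eq_zero _).2 ⟨_, rfl⟩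
  have hb : (1 : T) ⊗ₜ[R] q b = 0 := by
    have h1 : q b = ∑ k, σ k (b k) := by
      have : b = ∑ k, Pi.single k (b k) := by
        rw [Finset.univ_sum_single]
      conv_lhs => rw [this, map_sum]
      rfl
    have h3 : ∀ k, (1 : T) ⊗ₜ[R] σ k (b k) = ∑ j, f (p k) j • (σ k).lTensor T (h (Pi.single j 1)) := by
      intro k
      have h4 : (1 : T) ⊗ₜ[R] σ k (b k) = (σ k).lTensor T (h (f (p k))) := by
        rw [hh, LinearMap.lTensor_tmul]
      rw [h4]
      conv_lhs => rw [pi_eq_sum_univ' (f (p k))]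
      simp [map_sum]
    rw [h1, TensorProduct.tmul_sum, Finset.sum_congr rfl (fun k _ => h3 k), Finset.sum_comm]
    apply Finset.sum_eq_zero
    intro j _
    have h5 : ∑ k, f (p k) j • (σ k).lTensor T (h (Pi.single j 1)) =
        (LinearMap.lTensorHom T (∑ k, f (p k) j • σ k)) (h (Pi.single j 1)) := by
      rw [map_sum, LinearMap.sum_apply]
      simp
    rw [h5, hσ, map_zero, LinearMap.zero_apply]
  have hb0 : q b = 0 := hp C (by simpa using hb)
  obtain ⟨y, hy⟩ := (Submodule.Quotient.mk_eq_zero _).1 hb0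
  let h' : (Fin n → R) →ₗ[R] N := ∑ j, (LinearMap.proj j : (Fin n → R) →ₗ[R] R).smulRight (y j)
  refine ⟨h', ?_⟩
  have : h' ∘ₗ f = g := by
    apply LinearMap.ext_on hspan
    rintro _ ⟨k, rfl⟩
    have := congrFun hy k
    simpa [h', A, b, LinearMap.sum_apply] using this
  intro p
  exact DFunLike.congr_fun this p

def eta (R T N : Type u) [CommRing R] [CommRing T] [Algebra R T] [AddCommGroup N] [Module R N] :
    ModuleCat.of R N ⟶ ModuleCat.of R (T ⊗[R] N) := ModuleCat.ofHom (TensorProduct.mk R T N 1)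

lemma pure_ext [IsNoetherianRing R] (hp : IsPureAlgebra' R T) {N : Type u} [AddCommGroup N] [Module R N] (i : ℕ) :
    ∀ (P : Type u) [AddCommGroup P] [Module R P] [Module.Finite R P] (e : NExt (ModuleCat.of R P) (ModuleCat.of R N) i),
    e.comp (Ext.mk₀ (eta R T N)) (add_zero i) = 0 → e = 0 := by
  induction i with
  | zero =>
    intro P _ _ _ e he
    obtain ⟨φ, rfl⟩ := (Ext.mk₀_bijective _ _).2 e
    rw [Ext.mk₀_comp_mk₀, Ext.mk₀_eq_zero_iff] at he
    rw [Ext.mk₀_eq_zero_iff]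
    ext x
    apply hp N
    have := congrArg (fun ψ => ψ.hom x) he
    change (1 : T) ⊗ₜ[R] (φ.hom x) = (1 : T) ⊗ₜ[R] (0 : N)
    rw [TensorProduct.tmul_zero]
    exact this
  | succ i ih =>
    intro P _ _ _ e he
    obtain ⟨n, g, hg⟩ := Module.Finite.exists_fin' R P
    let K := LinearMap.ker g
    have hex : Function.Exact K.subtype g := by intro x; simp [K]
    have hS := sesC_exact K.subtype g hex K.injective_subtype hg
    have hproj : Projective (ModuleCat.of R (Fin n → R)) := inferInstance
    obtain ⟨x1, rfl⟩ := Ext.contravariant_sequence_exact₃ hS _ e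
      (Ext.eq_zero_of_projective (P := ModuleCat.of R (Fin n → R)) _) (add_comm 1 i)
    rw [Ext.comp_assoc_of_third_deg_zero] at he
    obtain ⟨x2, hx2⟩ := Ext.contravariant_sequence_exact₁ hS _ _ _ he
    cases i with
    | zero =>
      obtain ⟨φ, rfl⟩ := (Ext.mk₀_bijective _ _).2 x1
      obtain ⟨ψ, rfl⟩ := (Ext.mk₀_bijective _ _).2 x2
      rw [Ext.mk₀_comp_mk₀, Ext.mk₀_comp_mk₀] at hx2
      have h3 := (Ext.mk₀_bijective _ _).1 hx2
      obtain ⟨h', hh'⟩ := pure_ext_zero hp K.subtype φ.hom ψ.hom (fun p => congrArg (fun ψ => ψ.hom p) h3)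
      have : φ = (sesC K.subtype g hex).f ≫ ModuleCat.ofHom h' := by
        ext x; exact (hh' x).symm
      rw [this, ← Ext.mk₀_comp_mk₀]
      rw [hS.extClass_comp_assoc]
    | succ i =>
      have h0 : x2 = 0 := Ext.eq_zero_of_projective (P := ModuleCat.of R (Fin n → R)) _
      rw [h0, Ext.comp_zero] at hx2
      rw [ih K x1 hx2.symm, Ext.comp_zero]

lemma pure_subsingleton [IsNoetherianRing R] (hp : IsPureAlgebra' R T) {N : Type u} [AddCommGroup N] [Module R N] (i : ℕ)
    (P : Type u) [AddCommGroup P] [Module R P] [Module.Finite R P]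
    (h : Subsingleton (NExt (ModuleCat.of R P) (ModuleCat.of R (T ⊗[R] N)) i)) :
    Subsingleton (NExt (ModuleCat.of R P) (ModuleCat.of R N) i) :=
  subsingleton_of_forall_eq 0 fun e => pure_ext hp i P e (Subsingleton.elim _ _)

lemma pure_van [IsNoetherianRing R] (hp : IsPureAlgebra' R T) {N : Type u} [AddCommGroup N] [Module R N] (i : ℕ)
    (a : Ideal R) (h : van a i (T ⊗[R] N)) : van a i N := by
  intro n e
  obtain ⟨m, hm, h0⟩ := h n (e.comp (Ext.mk₀ (eta R T N)) (add_zero i))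
  refine ⟨m, hm, pure_ext hp i _ _ ?_⟩
  exact (pull_comp a hm e _ _).symm.trans h0
end Pure

section Reg
variable {R : Type u} [CommRing R] {T : Type u} [CommRing T] [Algebra R T]
open Abelian

/-- Vanishing of an Ext module. -/
def ES (X Y : ModuleCat.{u} R) (i : ℕ) : Prop := ∀ e : NExt X Y i, e = 0

lemma exists_regular [IsNoetherianRing T] (a : Ideal R) (N : Type u) [AddCommGroup N] [Module R N] [Module T N]
    [IsScalarTower R T N] [Module.Finite T N] (h : ∀ y : N, (∀ r ∈ a, r • y = 0) → y = 0) :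
    ∃ x ∈ a, Function.Injective (fun y : N => x • y) := by
  by_contra hcon
  push Not at hcon
  have hfin : (associatedPrimes T N).Finite := associatedPrimes.finite T N
  have hsub : (a : Set R) ⊆ ⋃ p ∈ (hfin.toFinset : Set (Ideal T)), ((Ideal.comap (algebraMap R T) p : Ideal R) : Set R) := by
    intro x hx
    have h1 := hcon x hx
    have h2 : ¬ IsSMulRegular N (algebraMap R T x) := by
      intro h3
      apply h1
      intro y z hyz
      apply h3
      simpa using hyz
    have h4 : algebraMap R T x ∈ ⋃ p ∈ associatedPrimes T N, (p : Set T) := by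
      rw [biUnion_associatedPrimes_eq_compl_regular]
      exact h2
    simp only [Set.mem_iUnion] at h4 ⊢
    obtain ⟨p, hp, hxp⟩ := h4
    exact ⟨p, by simpa using hp, hxp⟩
  have := (Ideal.subset_union_prime (f := fun p : Ideal T => Ideal.comap (algebraMap R T) p)
    (s := hfin.toFinset) ⊥ ⊥ (fun p hp _ _ => by
      have : p.IsPrime := (AssociatedPrimes.mem_iff.1 (hfin.mem_toFinset.1 hp)).isPrime
      exact Ideal.comap_isPrime _ _)).1 hsub
  obtain ⟨p, hp, hap⟩ := this
  have hp' : IsAssociatedPrime p N := AssociatedPrimes.mem_iff.1 (hfin.mem_toFinset.1 hp)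
  obtain ⟨hpp, y, hy⟩ := isAssociatedPrime_iff.1 hp'
  have hy0 : y = 0 := by
    apply h
    intro r hr
    have : algebraMap R T r ∈ p := hap hr
    rw [hy, Submodule.mem_colon_singleton, Submodule.mem_bot, algebraMap_smul] at this
    exact this
  apply hpp.ne_top
  rw [hy, hy0]
  simp

lemma ES_right {A B C : Type u} [AddCommGroup A] [Module R A] [AddCommGroup B] [Module R B]
    [AddCommGroup C] [Module R C] (f : A →ₗ[R] B) (g : B →ₗ[R] C) (h : Function.Exact f g)
    (hf : Function.Injective f) (hg : Function.Surjective g) {X : ModuleCat.{u} R} {i : ℕ}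
    (hA : ES X (ModuleCat.of R A) (i + 1)) (hB : ES X (ModuleCat.of R B) i) :
    ES X (ModuleCat.of R C) i := by
  intro e
  have hS := sesC_exact f g h hf hg
  obtain ⟨x, rfl⟩ := Ext.covariant_sequence_exact₃ _ hS e rfl (hA _)
  rw [hB x, Ext.zero_comp]

lemma exact_smul {N : Type u} [AddCommGroup N] [Module T N] (z : T) :
    Function.Exact (LinearMap.lsmul T N z) (LinearMap.range (LinearMap.lsmul T N z)).mkQ := by
  intro x; simp

lemma smul_ext_zero {X Y : ModuleCat.{u} R} {r : R} (hX : ∀ x : X, r • x = 0) {i : ℕ} (e : NExt X Y i) :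
    r • e = 0 := by
  have : r • 𝟙 X = 0 := by ext x; exact hX x
  have h2 : r • e = (Ext.mk₀ (r • 𝟙 X)).comp e (zero_add i) := by
    rw [Ext.mk₀_smul, Ext.smul_comp, Ext.mk₀_id_comp]
  rw [h2, this]; simp

/-- if `z` kills `X` and `0 → N → N → C → 0` with first map mult by `z`. -/
lemma ES_step {N C : Type u} [AddCommGroup N] [Module R N] [AddCommGroup C] [Module R C]
    (f : N →ₗ[R] N) (g : N →ₗ[R] C) (h : Function.Exact f g)
    (hf : Function.Injective f) (hg : Function.Surjective g) {X : ModuleCat.{u} R} {i : ℕ} (z : R)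
    (hz : ∀ y, f y = z • y) (hX : ∀ x : X, z • x = 0) (hC : ES X (ModuleCat.of R C) i) :
    ES X (ModuleCat.of R N) (i + 1) := by
  intro e
  have hS := sesC_exact f g h hf hg
  have h0 : e.comp (Ext.mk₀ (sesC f g h).f) (add_zero _) = 0 := by
    rw [show (sesC f g h).f = z • 𝟙 (ModuleCat.of R N) by ext y; exact hz y, ← Ext.smul_eq_comp_mk₀]
    exact smul_ext_zero hX e
  obtain ⟨x, rfl⟩ := Ext.covariant_sequence_exact₁ _ hS e h0 rfl
  rw [hC x, Ext.zero_comp]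

lemma ES_zero {N : Type u} [AddCommGroup N] [Module R N] {X : ModuleCat.{u} R} (z : R)
    (hz : Function.Injective (fun y : N => z • y)) (hX : ∀ x : X, z • x = 0) :
    ES X (ModuleCat.of R N) 0 := by
  intro e
  obtain ⟨φ, rfl⟩ := (Ext.mk₀_bijective _ _).2 e
  rw [Ext.mk₀_eq_zero_iff]
  ext x
  apply hz
  change z • φ.hom x = z • (0 : N)
  rw [smul_zero, ← map_smul, hX, map_zero]

lemma no_tors {a : Ideal R} {N : Type u} [AddCommGroup N] [Module R N]
    (h : ES (ModuleCat.of R (R ⧸ a)) (ModuleCat.of R N) 0) (y : N) (hy : ∀ r ∈ a, r • y = 0) : y = 0 := by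
  let φ : ModuleCat.of R (R ⧸ a) ⟶ ModuleCat.of R N :=
    ModuleCat.ofHom (Submodule.liftQ a (LinearMap.toSpanSingleton R N y) (fun r hr => hy r hr))
  have h1 := h (Ext.mk₀ φ)
  rw [Ext.mk₀_eq_zero_iff] at h1
  have := congrArg (fun ψ => ψ.hom (Ideal.Quotient.mk a 1)) h1
  exact (one_smul R y).symm.trans this

lemma quot_killed (a : Ideal R) {z : R} (hz : z ∈ a) (x : R ⧸ a) : z • x = 0 := by
  obtain ⟨y, rfl⟩ := Ideal.Quotient.mk_surjective x
  change Ideal.Quotient.mk a (z * y) = 0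
  exact Ideal.Quotient.eq_zero_iff_mem.2 (Ideal.mul_mem_right _ _ hz)

lemma pow_inj {N : Type u} [AddCommGroup N] [Module R N] {x : R} (h : Function.Injective (fun y : N => x • y))
    (n : ℕ) : Function.Injective (fun y : N => x ^ n • y) := by
  have : (fun y : N => x ^ n • y) = (fun y : N => x • y)^[n] := by
    ext y; simp
  rw [this]; exact h.iterate n

lemma ES_transfer [IsNoetherianRing T] (a : Ideal R) (g : ℕ) : ∀ (N : Type u) [AddCommGroup N] [Module R N] [Module T N]
    [IsScalarTower R T N] [Module.Finite T N],
    (∀ i < g, ES (ModuleCat.of T (T ⧸ a.map (algebraMap R T))) (ModuleCat.of T N) i) →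
    ∀ (X : ModuleCat.{u} R) (n : ℕ), (∀ r ∈ a ^ n, ∀ x : X, r • x = 0) → ∀ i < g, ES X (ModuleCat.of R N) i := by
  induction g with
  | zero => intro N _ _ _ _ _ _ X n hX i hi; omega
  | succ g ih =>
    intro N _ _ _ _ _ hT X n hX i hi
    obtain ⟨x, hxa, hx⟩ := exists_regular (T := T) a N (fun y hy => no_tors (hT 0 (by omega)) y (by
      simpa using (tors_iff (T := T) a 1 y).2 (by simpa using hy)))
    let z := x ^ n
    have hz : Function.Injective (fun y : N => z • y) := pow_inj hx n
    have hzX : ∀ y : X, z • y = 0 := fun y => hX z (Ideal.pow_mem_pow hxa n) y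
    cases i with
    | zero => exact ES_zero z hz hzX
    | succ i =>
      have hex := exact_smul (N := N) (algebraMap R T z)
      have hs := Submodule.mkQ_surjective (LinearMap.range (LinearMap.lsmul T N (algebraMap R T z)))
      have hf : Function.Injective (LinearMap.lsmul T N (algebraMap R T z)) := by
        intro y y' hyy
        apply hz
        simpa using hyy
      generalize (LinearMap.range (LinearMap.lsmul T N (algebraMap R T z))).mkQ = q at hex hs
      refine ES_step ((LinearMap.lsmul T N (algebraMap R T z)).restrictScalars R) (q.restrictScalars R) hex hf hs z
        (fun y => by simp) hzX (ih _ ?_ X n hX i (by omega))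
      intro k hk
      exact ES_right _ q hex hf hs (hT _ (by omega)) (hT _ (by omega))

lemma ES_of_van [IsNoetherianRing R] (a : Ideal R) (t : ℕ) : ∀ (M : Type u) [AddCommGroup M] [Module R M]
    [Module.Finite R M], (∀ i < t, ES (ModuleCat.of R (R ⧸ a)) (ModuleCat.of R M) i) → van a t M →
    ES (ModuleCat.of R (R ⧸ a)) (ModuleCat.of R M) t := by
  induction t with
  | zero =>
    intro M _ _ _ _ hv e
    obtain ⟨φ, rfl⟩ := (Ext.mk₀_bijective _ _).2 e
    rw [show φ = 0 from cyc_ext (van_zero_iff.1 hv 1 _ (by simpa using! cyc_tors φ)), Ext.mk₀_zero]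
  | succ t ih =>
    intro M _ _ _ hE hv
    obtain ⟨x, hxa, hx⟩ := exists_regular (T := R) a M (fun y hy => no_tors (hE 0 (by omega)) y hy)
    have hvt : van a t M := by
      intro n e
      refine ⟨n, le_rfl, ?_⟩
      have := ES_transfer (T := R) a (t + 1) M (by rw [show a.map (algebraMap R R) = a from Ideal.map_id a]; exact hE) (ModuleCat.of R (R ⧸ a ^ n)) n
        (fun r hr y => quot_killed _ hr y) t (by omega) e
      rw [this]; simp
    have hex := exact_smul (N := M) x
    have hs := Submodule.mkQ_surjective (LinearMap.range (LinearMap.lsmul R M x))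
    have hf : Function.Injective (LinearMap.lsmul R M x) := hx
    have : Module.Finite R (M ⧸ LinearMap.range (LinearMap.lsmul R M x)) := inferInstance
    generalize (LinearMap.range (LinearMap.lsmul R M x)).mkQ = q at hex hs
    refine ES_step (LinearMap.lsmul R M x) q hex hf hs x (fun y => by simp) (fun y => quot_killed a hxa y) (ih _ ?_ ?_)
    · intro k hk
      exact ES_right _ q hex hf hs (hE _ (by omega)) (hE _ (by omega))
    · exact van_right _ q hex hf hs hv hvt

lemma van_pi (a : Ideal R) (i : ℕ) (h : van a i R) (n : ℕ) : van a i (Fin n → R) := by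
  induction n with
  | zero => exact van_subsingleton
  | succ n ih =>
    refine van_mid (LinearMap.single R (fun _ : Fin (n + 1) => R) 0) (LinearMap.funLeft R R Fin.succ) ?_ ?_ ?_ h ih
    · intro v
      constructor
      · intro hv
        refine ⟨v 0, ?_⟩
        ext k
        refine Fin.cases ?_ (fun k => ?_) k
        · simp
        · have := congrFun hv k
          simpa using this.symm
      · rintro ⟨r, rfl⟩
        ext k
        simp
    · intro r s hrs; simpa using congrFun hrs 0
    · exact LinearMap.funLeft_surjective_of_injective _ _ _ (Fin.succ_injective n)

lemma van_fg [IsNoetherianRing R] (a : Ideal R) (t : ℕ) (h : ∀ i, t ≤ i → van a i R) :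
    ∀ i, t ≤ i → ∀ (N : Type u) [AddCommGroup N] [Module R N] [Module.Finite R N], van a i N := by
  obtain ⟨r, hr⟩ := exists_cd_bound a
  have key : ∀ d : ℕ, ∀ i, t ≤ i → r < i + d →
      ∀ (N : Type u) [AddCommGroup N] [Module R N] [Module.Finite R N], van a i N := by
    intro d
    induction d with
    | zero => intro i _ hi N _ _ _; exact hr N i hi
    | succ d ih =>
      intro i hti hi N _ _ _
      obtain ⟨n, g, hg⟩ := Module.Finite.exists_fin' R N
      have hex : Function.Exact (LinearMap.ker g).subtype g := by intro x; simp
      exact van_right _ g hex (LinearMap.ker g).injective_subtype hg (ih (i + 1) (by omega) (by omega) _)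
        (van_pi a i (h i hti) n)
  intro i hi N _ _ _
  exact key (r + 1) i hi (by omega) N

lemma smul_top_of_ES [IsNoetherianRing R] (a : Ideal R) (M : Type u) [AddCommGroup M] [Module R M] [Module.Finite R M]
    (h : ∀ i, ES (ModuleCat.of R (R ⧸ a)) (ModuleCat.of R M) i) : a • (⊤ : Submodule R M) = ⊤ := by
  have key : ∀ L : Submodule R M, ∀ (N : Type u) [AddCommGroup N] [Module R N] (φ : M →ₗ[R] N),
      Function.Surjective φ → LinearMap.ker φ = L →
      (∀ i, ES (ModuleCat.of R (R ⧸ a)) (ModuleCat.of R N) i) → a • (⊤ : Submodule R N) = ⊤ := by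
    intro L
    induction L using WellFoundedGT.induction with
    | ind L ih =>
      intro N _ _ φ hφ hL hE
      have : Module.Finite R N := Module.Finite.of_surjective φ hφ
      by_cases hN : Subsingleton N
      · exact Subsingleton.elim _ _
      obtain ⟨x, hxa, hx⟩ := exists_regular (T := R) a N (fun y hy => no_tors (hE 0) y hy)
      have hex := exact_smul (N := N) x
      let Z := LinearMap.range (LinearMap.lsmul R N x)
      have hs := Submodule.mkQ_surjective Z
      have hf : Function.Injective (LinearMap.lsmul R N x) := hx
      have h1 := ih (LinearMap.ker (Z.mkQ ∘ₗ φ)) ?_ (N ⧸ Z) (Z.mkQ ∘ₗ φ) (hs.comp hφ) rfl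
        (fun i => ES_right _ Z.mkQ hex hf hs (hE _) (hE _))
      · have h2 : Submodule.map Z.mkQ (a • (⊤ : Submodule R N)) = ⊤ := by
          rw [Submodule.map_smul'', Submodule.map_top, Submodule.range_mkQ, h1]
        have hZ : Z ≤ a • (⊤ : Submodule R N) := by
          rintro _ ⟨y, rfl⟩
          exact Submodule.smul_mem_smul hxa Submodule.mem_top
        rw [eq_top_iff]
        intro y _
        have : Z.mkQ y ∈ Submodule.map Z.mkQ (a • (⊤ : Submodule R N)) := by rw [h2]; trivial
        obtain ⟨w, hw, hwy⟩ := this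
        have h3 : w - y ∈ Z := by
          rw [← Submodule.Quotient.mk_eq_zero (p := Z)]
          have : Z.mkQ (w - y) = 0 := by rw [map_sub, hwy, sub_self]
          exact this
        have := Submodule.sub_mem _ hw (hZ h3)
        simpa using this
      · rw [← hL]
        refine lt_of_le_of_ne (fun y hy => ?_) (fun heq => hN ?_)
        · rw [LinearMap.mem_ker] at hy ⊢
          rw [LinearMap.comp_apply, hy, map_zero]
        · refine subsingleton_of_forall_eq 0 fun y => hx ?_
          obtain ⟨m, rfl⟩ := hφ y
          have : x • m ∈ LinearMap.ker φ := by
            rw [heq, LinearMap.mem_ker, LinearMap.comp_apply, map_smul]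
            exact (Submodule.Quotient.mk_eq_zero _).2 ⟨φ m, rfl⟩
          rw [LinearMap.mem_ker, map_smul] at this
          change x • φ m = x • (0 : N)
          rw [this, smul_zero]
  exact key _ M LinearMap.id Function.surjective_id rfl h

lemma ES_of_smul_top (a : Ideal R) (M : Type u) [AddCommGroup M] [Module R M] [Module.Finite R M]
    (h : a • (⊤ : Submodule R M) = ⊤) (i : ℕ) :
    ES (ModuleCat.of T (T ⧸ a.map (algebraMap R T))) (ModuleCat.of T (T ⊗[R] M)) i := by
  obtain ⟨r, hr, hrM⟩ := Submodule.exists_mem_and_smul_eq_self_of_fg_of_le_smul a (⊤ : Submodule R M)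
    Module.Finite.fg_top h.ge
  intro e
  refine ext_zero_of_bij (r := algebraMap R T r) (fun y => quot_killed _ (Ideal.mem_map_of_mem _ hr) y) ?_ e
  have : (fun y : T ⊗[R] M => algebraMap R T r • y) = id := by
    ext y
    rw [algebraMap_smul]
    induction y using TensorProduct.induction_on with
    | zero => simp
    | tmul t m => rw [← TensorProduct.tmul_smul, hrM m trivial]; rfl
    | add x y hx hy => rw [smul_add, hx, hy]; rfl
  change Function.Bijective (fun y : T ⊗[R] M => algebraMap R T r • y)
  rw [this]
  exact Function.bijective_id
end Reg

lemma relGrade_le_iff {R : Type u} [CommRing R] (a : Ideal R)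
    (M : Type u) [AddCommGroup M] [Module R M] (g : ℕ) (hg : ¬ ES (ModuleCat.of R (R ⧸ a)) (ModuleCat.of R M) g)
    (h : ∀ i < g, ES (ModuleCat.of R (R ⧸ a)) (ModuleCat.of R M) i) : relGrade a M = g := by
  apply le_antisymm
  · apply sInf_le
    refine ⟨g, (OExt_nontrivial_iff _ _).2 ?_, rfl⟩
    rw [← not_subsingleton_iff_nontrivial]
    exact fun hs => hg fun e => Subsingleton.elim _ _
  · apply le_sInf
    rintro _ ⟨i, hi, rfl⟩
    have hi' := (OExt_nontrivial_iff _ _).1 hi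
    by_contra hlt
    have hlt : i < g := by simpa using hlt
    obtain ⟨x, hx⟩ := exists_ne (0 : NExt (ModuleCat.of R (R ⧸ a)) (ModuleCat.of R M) i)
    exact hx (h i hlt x)

lemma relGrade_top {R : Type u} [CommRing R] (a : Ideal R)
    (M : Type u) [AddCommGroup M] [Module R M]
    (h : ∀ i, ES (ModuleCat.of R (R ⧸ a)) (ModuleCat.of R M) i) : relGrade a M = ⊤ := by
  rw [eq_top_iff]
  apply le_sInf
  rintro _ ⟨i, hi, rfl⟩
  have hi' := (OExt_nontrivial_iff _ _).1 hi
  obtain ⟨x, hx⟩ := exists_ne (0 : NExt (ModuleCat.of R (R ⧸ a)) (ModuleCat.of R M) i)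
  exact absurd (h i x) hx

lemma LC_nontrivial_iff {R : Type u} [CommRing R] (a : Ideal R) (i : ℕ)
    (M : Type u) [AddCommGroup M] [Module R M] :
    Nontrivial ((localCohomology a i).obj (ModuleCat.of R M)) ↔ ¬ van a i M := by
  rw [← not_subsingleton_iff_nontrivial, subsingleton_LC_iff]
  rfl

lemma cohDim_le {R : Type u} [CommRing R] (a : Ideal R)
    (M : Type u) [AddCommGroup M] [Module R M] (r : ℕ) (h : ∀ i, r < i → van a i M) : cohDim a M ≤ r := by
  apply sSup_le
  rintro _ ⟨i, hi, rfl⟩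
  by_contra hlt
  have hlt : r < i := by simpa using hlt
  exact (LC_nontrivial_iff a i M).1 hi (h i hlt)

lemma van_of_cohDim {R : Type u} [CommRing R] (a : Ideal R)
    (M : Type u) [AddCommGroup M] [Module R M] (i : ℕ) (h : cohDim a M < i) : van a i M := by
  by_contra hv
  exact absurd (le_sSup ⟨i, (LC_nontrivial_iff a i M).2 hv, rfl⟩ : (i : ℕ∞) ≤ cohDim a M) (not_le.2 h)

theorem stmt3 {R T : Type u} [CommRing R] [CommRing T] [Algebra R T]
    [IsNoetherianRing R] [IsNoetherianRing T]
    (hpure : IsPureAlgebra R T) (a : Ideal R) (ha : a ≠ ⊤)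
    (M : Type u) [AddCommGroup M] [Module R M] [Module.Finite R M]
    (h : IsRelMCM (a.map (algebraMap R T)) (T ⊗[R] M)) :
    IsRelMCM a M := by
  have hp : IsPureAlgebra' R T := fun N _ _ => hpure N
  unfold IsRelMCM at h ⊢
  have hex : ∃ i, ¬ ES (ModuleCat.of T (T ⧸ a.map (algebraMap R T))) (ModuleCat.of T (T ⊗[R] M)) i := by
    by_contra hcon
    push Not at hcon
    rw [relGrade_top _ _ hcon] at h
    obtain ⟨r, hr⟩ := exists_cd_bound (a.map (algebraMap R T))
    have := cohDim_le (a.map (algebraMap R T)) T r (fun i hi => hr T i hi)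
    rw [← h, top_le_iff] at this
    exact ENat.coe_ne_top _ this
  classical
  obtain ⟨g, hg, hmin⟩ : ∃ g, ¬ ES (ModuleCat.of T (T ⧸ a.map (algebraMap R T))) (ModuleCat.of T (T ⊗[R] M)) g ∧
      ∀ i < g, ES (ModuleCat.of T (T ⧸ a.map (algebraMap R T))) (ModuleCat.of T (T ⊗[R] M)) i :=
    ⟨Nat.find hex, Nat.find_spec hex, fun i hi => not_not.1 (Nat.find_min hex hi)⟩
  rw [relGrade_le_iff _ _ g hg hmin] at h
  have hvT : ∀ i, g < i → van (a.map (algebraMap R T)) i T := fun i hi =>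
    van_of_cohDim _ _ i (by rw [← h]; exact_mod_cast hi)
  have hlow : ∀ i < g, ES (ModuleCat.of R (R ⧸ a)) (ModuleCat.of R M) i := by
    intro i hi
    have h1 := ES_transfer (T := T) a g (T ⊗[R] M) hmin (ModuleCat.of R (R ⧸ a)) 1
      (fun r hr x => quot_killed a (by simpa using hr) x) i hi
    have h2 := pure_subsingleton hp i (R ⧸ a) (N := M) (subsingleton_of_forall_eq 0 h1)
    exact fun e => Subsingleton.elim _ _
  have hvR : ∀ i, g < i → van a i R := by
    intro i hi
    apply pure_van hp
    exact van_equiv (TensorProduct.rid R T) (van_restrict a i T (hvT i hi))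
  have hgR : ¬ ES (ModuleCat.of R (R ⧸ a)) (ModuleCat.of R M) g := by
    intro hE
    have hall : ∀ i, ES (ModuleCat.of R (R ⧸ a)) (ModuleCat.of R M) i := by
      intro i
      induction i using Nat.strong_induction_on with
      | _ i ih =>
        rcases lt_trichotomy i g with hi | rfl | hi
        · exact hlow i hi
        · exact hE
        · exact ES_of_van a i M ih (van_fg a (g + 1) (fun j hj => hvR j hj) i hi M)
    exact hg (ES_of_smul_top (T := T) a M (smul_top_of_ES a M hall) g)
  rw [relGrade_le_iff _ _ g hgR hlow]
  apply le_antisymm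
  · apply le_sSup
    refine ⟨g, (LC_nontrivial_iff a g R).2 fun hv => hgR ?_, rfl⟩
    refine ES_of_van a g M hlow (van_fg a g (fun j hj => ?_) g le_rfl M)
    rcases hj.eq_or_lt with rfl | hj
    · exact hv
    · exact hvR j hj
  · exact cohDim_le a R g hvR

end
end

section
/- Let f : R → T be a pure ring homomorphism, 𝔞 an ideal of R contained in its Jacobson radical with μ(𝔞) = cd(𝔞, R), and M a finitely generated R-module. If T ⊗_R M is 𝔞T-relative regular, then M is 𝔞-relative regular. -/
open CategoryTheory TensorProduct

noncomputable section

universe u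

/-- `μ(𝔞)`: the minimal number of generators of the ideal `𝔞`, as an element of `ℕ∞`. -/
noncomputable def idealMu {R : Type u} [CommRing R] (a : Ideal R) : ℕ∞ :=
  sInf ((fun n : ℕ => (n : ℕ∞)) ''
    {n : ℕ | ∃ s : Finset R, s.card = n ∧ Ideal.span (s : Set R) = a})

section helpers
open Limits Opposite
open scoped Pointwise

section

theorem aux_homologyOp {R : Type u} [CommRing R] {K K' : ChainComplex (ModuleCat.{u} R)ᵒᵖ ℕ}
    (φ : K' ⟶ K) (n p : ℕ) (z : (K.opcycles n).unop) 
    (h : (K'.X p).unop) (hh : (φ.f n).unop ((K.pOpcycles n).unop z) = (K'.d n p).unop h) :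
    (HomologicalComplex.homologyMap φ n).unop ((K.homologyι n).unop z) = 0 := by
  have e1 : (K.homologyι n).unop ≫ (HomologicalComplex.homologyMap φ n).unop
      = (HomologicalComplex.opcyclesMap φ n).unop ≫ (K'.homologyι n).unop := by
    rw [← unop_comp, ← unop_comp, HomologicalComplex.homologyι_naturality]
  have e2 : (HomologicalComplex.opcyclesMap φ n).unop z = (K'.fromOpcycles n p).unop h := by
    have : Mono (K'.pOpcycles n).unop := inferInstance
    apply (ModuleCat.mono_iff_injective _).1 this
    have e3 : (HomologicalComplex.opcyclesMap φ n).unop ≫ (K'.pOpcycles n).unop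
      = (K.pOpcycles n).unop ≫ (φ.f n).unop := by
      rw [← unop_comp, ← unop_comp, HomologicalComplex.p_opcyclesMap]
    have e4 : (K'.fromOpcycles n p).unop ≫ (K'.pOpcycles n).unop = (K'.d n p).unop := by
      rw [← unop_comp, HomologicalComplex.p_fromOpcycles]
    have e3' := congr($e3 z)
    have e4' := congr($e4 h)
    simp only [ModuleCat.hom_comp, LinearMap.comp_apply] at e3' e4'
    rw [e3', e4', hh]
  have e5 : (K'.fromOpcycles n p).unop ≫ (K'.homologyι n).unop = 0 := by
    rw [← unop_comp, HomologicalComplex.homologyι_comp_fromOpcycles]; rfl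
  have e1' := congr($e1 z)
  have e5' := congr($e5 h)
  simp only [ModuleCat.hom_comp, LinearMap.comp_apply] at e1' e5'
  rw [e1', e2, e5']
  rfl

theorem oldExt_link {R : Type u} [CommRing R] {X Y : ModuleCat.{u} R} (p : ℕ)
    (x : ((Ext R (ModuleCat.{u} R) (p+1)).obj (op X)).obj Y) :
    ∃ c : Abelian.Ext.{u} X Y (p+1), ∀ (X' : ModuleCat.{u} R) (g : X' ⟶ X),
      (Abelian.Ext.mk₀ g).comp c (zero_add _) = 0 →
      (((Ext R (ModuleCat.{u} R) (p+1)).map g.op).app Y) x = 0 := by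
  let P := projectiveResolution X
  let F := ((linearYoneda R (ModuleCat.{u} R)).obj Y).rightOp
  let K := (F.mapHomologicalComplex (ComplexShape.down ℕ)).obj P.complex
  let x' := (P.isoLeftDerivedObj F (p+1)).inv.unop x
  have : Epi (K.homologyι (p+1)).unop := inferInstance
  obtain ⟨z, hz⟩ := (ModuleCat.epi_iff_surjective _).1 this x'
  let f : P.complex.X (p+1) ⟶ Y := (K.pOpcycles (p+1)).unop z
  have hf : P.complex.d (p+1+1) (p+1) ≫ f = 0 := by
    have e : (K.pOpcycles (p+1)).unop ≫ (K.d (p+1+1) (p+1)).unop = 0 := by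
      rw [← unop_comp, HomologicalComplex.d_pOpcycles]; rfl
    exact congr($e z)
  refine ⟨P.extMk f _ rfl hf, fun X' g hg => ?_⟩
  let P' := projectiveResolution X'
  let φ : ProjectiveResolution.Hom P' P g :=
    ⟨ProjectiveResolution.lift g P' P, by
      simpa using ProjectiveResolution.lift_commutes_zero g P' P⟩
  rw [ProjectiveResolution.mk₀_comp_extMk f _ rfl hf φ,
    ProjectiveResolution.extMk_eq_zero_iff _ _ _ _ _ p rfl] at hg
  obtain ⟨h, hh⟩ := hg
  have nat := ProjectiveResolution.isoLeftDerivedObj_inv_naturality g P' P φ.hom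
    (by simpa using φ.hom_f_zero_comp_π_f_zero) F (p+1)
  have main := aux_homologyOp (K := K)
    (K' := (F.mapHomologicalComplex (ComplexShape.down ℕ)).obj P'.complex)
    ((F.mapHomologicalComplex (ComplexShape.down ℕ)).map φ.hom) (p+1) p z h hh.symm
  rw [hz] at main
  have nat' : ((F.leftDerived (p+1)).map g).unop ≫ (P'.isoLeftDerivedObj F (p+1)).inv.unop =
     (P.isoLeftDerivedObj F (p+1)).inv.unop ≫ ((F.mapHomologicalComplex _ ⋙ HomologicalComplex.homologyFunctor _ _ (p+1)).map φ.hom).unop := by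
    rw [← unop_comp, ← unop_comp, nat]
  have nat'' := congr($nat' x)
  have inj : Mono (P'.isoLeftDerivedObj F (p+1)).inv.unop := inferInstance
  apply (ModuleCat.mono_iff_injective _).1 inj
  exact (nat''.trans main).trans (map_zero ((P'.isoLeftDerivedObj F (p+1)).inv.unop).hom).symm

/-- the projection `R/a^t' → R/a^t`. -/
def powProj {R : Type u} [CommRing R] (a : Ideal R) {t t' : ℕ} (h : t ≤ t') :
    ModuleCat.of R (R ⧸ a ^ t') ⟶ ModuleCat.of R (R ⧸ a ^ t) :=
  ModuleCat.ofHom (Submodule.mapQ _ _ LinearMap.id (Ideal.pow_le_pow_right h))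

/-- every class in `Ext^i(R/a^t, N)` dies at a later stage. -/
def Van {R : Type u} [CommRing R] (a : Ideal R) (i : ℕ) (N : ModuleCat.{u} R) : Prop :=
  ∀ (t : ℕ) (c : Abelian.Ext.{u} (ModuleCat.of R (R ⧸ a ^ t)) N i),
    ∃ (t' : ℕ) (h : t ≤ t'), (Abelian.Ext.mk₀ (powProj a h)).comp c (zero_add _) = 0

theorem subsingleton_localCohomology {R : Type u} [CommRing R] (a : Ideal R) (p : ℕ)
    (N : ModuleCat.{u} R) (h : Van a (p+1) N) :
    Subsingleton ((localCohomology a (p+1)).obj N) := by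
  let D := localCohomology.diagram (localCohomology.idealPowersDiagram a) (p+1)
  have : HasColimit D := localCohomology.hasColimitDiagram.{u,0} _ _
  let G := D ⋙ (evaluation _ _).obj N
  let e : (localCohomology a (p+1)).obj N ≅ colimit G := colimitObjIsoColimitCompEvaluation D N
  have hι : ∀ j, colimit.ι G j = 0 := by
    intro j
    ext x
    obtain ⟨c, hc⟩ := oldExt_link p (X := ModuleCat.of R (R ⧸ a ^ (unop (unop j)))) (Y := N) x
    obtain ⟨t', ht', h0⟩ := h _ c
    have := hc _ _ h0
    let j' : ℕᵒᵖᵒᵖ := op (op t')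
    let m : j ⟶ j' := (homOfLE ht').op.op
    have hx : G.map m x = 0 := this
    change colimit.ι G j x = 0
    rw [← colimit.w_apply G m x, hx, map_zero]
  have hid : 𝟙 (colimit G) = 0 := colimit.hom_ext fun j => by rw [hι j, zero_comp, zero_comp]
  have hG : ∀ y : (colimit G : ModuleCat.{u} R), y = 0 := fun y => congr($hid y)
  refine ⟨fun y z => ?_⟩
  have : Function.Injective e.hom := (ModuleCat.mono_iff_injective _).1 inferInstance
  apply this
  rw [hG (e.hom y), hG (e.hom z)]

end

section
variable {R : Type u} [CommRing R]

theorem powProj_comp (a : Ideal R) {t t' t'' : ℕ} (h : t ≤ t') (h' : t' ≤ t'') :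
    powProj a h' ≫ powProj a h = powProj a (h.trans h') := by
  ext : 1
  apply Submodule.linearMap_qext
  rfl

theorem dies_of_dies (a : Ideal R) {i : ℕ} {N : ModuleCat.{u} R} {t t' t'' : ℕ}
    (c : Abelian.Ext.{u} (ModuleCat.of R (R ⧸ a ^ t)) N i) (h : t ≤ t') (h' : t' ≤ t'')
    (hc : (Abelian.Ext.mk₀ (powProj a h')).comp ((Abelian.Ext.mk₀ (powProj a h)).comp c
      (zero_add _)) (zero_add _) = 0) :
    (Abelian.Ext.mk₀ (powProj a (h.trans h'))).comp c (zero_add _) = 0 := by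
  rw [← powProj_comp a h h', ← Abelian.Ext.mk₀_comp_mk₀_assoc, hc]

theorem Van.middle {a : Ideal R} {i : ℕ} {S : ShortComplex (ModuleCat.{u} R)} (hS : S.ShortExact)
    (h1 : Van a i S.X₁) (h3 : Van a i S.X₃) : Van a i S.X₂ := by
  intro t c
  obtain ⟨t', ht', h0⟩ := h3 t (c.comp (Abelian.Ext.mk₀ S.g) (add_zero _))
  obtain ⟨d, hd⟩ := Abelian.Ext.covariant_sequence_exact₂ _ hS
    ((Abelian.Ext.mk₀ (powProj a ht')).comp c (zero_add _))
    (by rw [Abelian.Ext.comp_assoc_of_third_deg_zero, h0])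
  obtain ⟨t'', ht'', h0'⟩ := h1 t' d
  refine ⟨t'', ht'.trans ht'', dies_of_dies a c ht' ht'' ?_⟩
  rw [← hd, ← Abelian.Ext.comp_assoc_of_third_deg_zero, h0', Abelian.Ext.zero_comp]

theorem Van.left {a : Ideal R} {i : ℕ} {S : ShortComplex (ModuleCat.{u} R)} (hS : S.ShortExact)
    (h3 : Van a i S.X₃) (h2 : Van a (i+1) S.X₂) : Van a (i+1) S.X₁ := by
  intro t c
  obtain ⟨t', ht', h0⟩ := h2 t (c.comp (Abelian.Ext.mk₀ S.f) (add_zero _))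
  obtain ⟨d, hd⟩ := Abelian.Ext.covariant_sequence_exact₁ _ hS
    ((Abelian.Ext.mk₀ (powProj a ht')).comp c (zero_add _))
    (by rw [Abelian.Ext.comp_assoc_of_third_deg_zero, h0]) rfl
  obtain ⟨t'', ht'', h0'⟩ := h3 t' d
  refine ⟨t'', ht'.trans ht'', dies_of_dies a c ht' ht'' ?_⟩
  rw [← hd, ← Abelian.Ext.comp_assoc (Abelian.Ext.mk₀ (powProj a ht'')) d hS.extClass
    (zero_add _) rfl (by omega), h0', Abelian.Ext.zero_comp]

/-- an element of the annihilator of `X` acts by zero on `Ext X Y i` -/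
theorem ext_smul_eq_zero {X Y : ModuleCat.{u} R} {i : ℕ} (r : R) (hr : ∀ x : X, r • x = 0)
    (c : Abelian.Ext.{u} X Y i) : c.comp (Abelian.Ext.mk₀ (r • 𝟙 Y)) (add_zero _) = 0 := by
  have h1 : r • (𝟙 X) = 0 := by ext x; exact hr x
  have h2 : r • c = 0 := by
    have := Abelian.Ext.mk₀_id_comp c
    rw [← this, ← Abelian.Ext.smul_comp, ← Abelian.Ext.mk₀_smul, h1]
    simp
  rw [← Abelian.Ext.smul_eq_comp_mk₀]; exact h2

theorem van_of_isUnit {a : Ideal R} {N : ModuleCat.{u} R} (x : R) (hx : x ∈ a)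
    (hN : Function.Bijective (fun u : N => x • u)) (i : ℕ) : Van a i N := by
  intro t c
  refine ⟨t, le_rfl, ?_⟩
  have hb : Function.Bijective (fun u : N => x ^ t • u) := by
    have : (fun u : N => x ^ t • u) = (fun u : N => x • u)^[t] := by
      rw [smul_iterate]
    rw [this]; exact hN.iterate t
  have h0 := ext_smul_eq_zero (X := ModuleCat.of R (R ⧸ a ^ t)) (x ^ t) (by
    intro y
    obtain ⟨y, rfl⟩ := Ideal.Quotient.mk_surjective y
    change Ideal.Quotient.mk (a^t) (x ^ t * y) = 0
    rw [Ideal.Quotient.eq_zero_iff_mem]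
    exact Ideal.mul_mem_right _ _ (Ideal.pow_mem_pow hx t)) c
  have : IsIso (x ^ t • 𝟙 N) := by
    rw [ConcreteCategory.isIso_iff_bijective]; exact hb
  have h1 : c = 0 := by
    have h2 := congr($(h0).comp (Abelian.Ext.mk₀ (inv (x ^ t • 𝟙 N))) (add_zero _))
    rw [Abelian.Ext.comp_assoc_of_third_deg_zero, Abelian.Ext.mk₀_comp_mk₀,
      IsIso.hom_inv_id, Abelian.Ext.comp_mk₀_id, Abelian.Ext.zero_comp] at h2
    exact h2
  rw [h1, Abelian.Ext.comp_zero]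

theorem van_of_subsingleton {a : Ideal R} {N : ModuleCat.{u} R} [Subsingleton N] (i : ℕ) :
    Van a i N :=
  fun t c => ⟨t, le_rfl, by
    have h1 : (𝟙 N) = 0 := by ext x; exact Subsingleton.elim _ _
    have : c = 0 := by rw [← Abelian.Ext.comp_mk₀_id c, h1]; simp
    simp [this]⟩
end

section
variable {R : Type u} [CommRing R]

/-- `N` is `b`-torsion. -/
def Tors (b : Ideal R) (N : Type u) [AddCommGroup N] [Module R N] : Prop :=
  ∀ u : N, b ≤ (Ideal.torsionOf R N u).radical

theorem mem_rad_tors {N : Type u} [AddCommGroup N] [Module R N] (r : R) (u : N) :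
    r ∈ (Ideal.torsionOf R N u).radical ↔ ∃ k, r ^ k • u = 0 := Iff.rfl

/-- the `a`-torsion submodule. -/
def gammaSub (a : Ideal R) (E : Type u) [AddCommGroup E] [Module R E] : Submodule R E where
  carrier := {u | a ≤ (Ideal.torsionOf R E u).radical}
  add_mem' := by
    intro u v hu hv r hr
    obtain ⟨k, hk⟩ := (mem_rad_tors r u).1 (hu hr)
    obtain ⟨l, hl⟩ := (mem_rad_tors r v).1 (hv hr)
    refine (mem_rad_tors r _).2 ⟨k + l, ?_⟩
    rw [smul_add, pow_add, mul_smul _ _ v, hl, mul_comm, mul_smul, hk]; simp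
  zero_mem' := fun r _ => (mem_rad_tors r _).2 ⟨0, by simp⟩
  smul_mem' := by
    intro c u hu r hr
    obtain ⟨k, hk⟩ := (mem_rad_tors r u).1 (hu hr)
    exact (mem_rad_tors r _).2 ⟨k, by rw [smul_comm, hk, smul_zero]⟩

theorem tors_gamma (a : Ideal R) (E : Type u) [AddCommGroup E] [Module R E] :
    Tors a (gammaSub a E) := by
  rintro ⟨u, hu⟩ r hr
  obtain ⟨k, hk⟩ := (mem_rad_tors r u).1 (hu hr)
  exact (mem_rad_tors r _).2 ⟨k, by ext; simpa using hk⟩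

theorem Tors.of_injective {b : Ideal R} {N N' : Type u} [AddCommGroup N] [Module R N]
    [AddCommGroup N'] [Module R N'] (h : Tors b N') (f : N →ₗ[R] N') (hf : Function.Injective f) :
    Tors b N := by
  intro u r hr
  obtain ⟨k, hk⟩ := (mem_rad_tors r _).1 (h (f u) hr)
  exact (mem_rad_tors r _).2 ⟨k, hf (by simpa using hk)⟩

theorem Tors.of_surjective {b : Ideal R} {N N' : Type u} [AddCommGroup N] [Module R N]
    [AddCommGroup N'] [Module R N'] (h : Tors b N) (f : N →ₗ[R] N') (hf : Function.Surjective f) :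
    Tors b N' := by
  intro u r hr
  obtain ⟨u, rfl⟩ := hf u
  obtain ⟨k, hk⟩ := (mem_rad_tors r _).1 (h u hr)
  exact (mem_rad_tors r _).2 ⟨k, by rw [← map_smul, hk, map_zero]⟩

theorem Tors.exists_pow [IsNoetherianRing R] {a : Ideal R} {N : Type u} [AddCommGroup N]
    [Module R N] (h : Tors a N) (u : N) : ∃ k, ∀ r ∈ a ^ k, r • u = 0 := by
  obtain ⟨k, hk⟩ := Ideal.exists_pow_le_of_le_radical_of_fg (h u) (IsNoetherian.noetherian a)
  exact ⟨k, fun r hr => by simpa using hk hr⟩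

theorem Tors.exists_pow_fg [IsNoetherianRing R] {a : Ideal R} {N : Type u} [AddCommGroup N]
    [Module R N] (h : Tors a N) (W : Submodule R N) (hW : W.FG) :
    ∃ k, ∀ r ∈ a ^ k, ∀ w ∈ W, r • w = 0 := by
  induction W, hW using Submodule.fg_induction with
  | singleton x =>
    obtain ⟨k, hk⟩ := h.exists_pow x
    refine ⟨k, fun r hr w hw => ?_⟩
    obtain ⟨c, rfl⟩ := Submodule.mem_span_singleton.1 hw
    rw [smul_comm, hk r hr, smul_zero]
  | sup M₁ M₂ _ _ h1 h2 =>
    obtain ⟨k, hk⟩ := h1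
    obtain ⟨l, hl⟩ := h2
    refine ⟨max k l, fun r hr w hw => ?_⟩
    obtain ⟨y, hy, z, hz, rfl⟩ := Submodule.mem_sup.1 hw
    rw [smul_add, hk r (Ideal.pow_le_pow_right (le_max_left _ _) hr) y hy,
      hl r (Ideal.pow_le_pow_right (le_max_right _ _) hr) z hz, add_zero]

theorem injective_gamma [IsNoetherianRing R] (a : Ideal R) (E : Type u) [AddCommGroup E]
    [Module R E] [hE : Module.Injective R E] : Module.Injective R (gammaSub a E) := by
  apply Module.Baer.injective
  intro I g
  obtain ⟨s, hs⟩ := (tors_gamma a E).exists_pow_fg (LinearMap.range g)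
    (by rw [LinearMap.range_eq_map]; exact (IsNoetherian.noetherian (⊤ : Submodule R I)).map g)
  obtain ⟨k, hk⟩ := Ideal.exists_pow_inf_eq_pow_smul a I
  have hle : ∀ x (hx : x ∈ I), x ∈ a ^ (s + k) → g ⟨x, hx⟩ = 0 := by
    intro x hx hxa
    have h1 : x ∈ a ^ s • I := by
      have := hk (s + k) (by omega)
      have h2 : x ∈ (a ^ (s + k) • ⊤ ⊓ I : Submodule R R) := ⟨by simpa using hxa, hx⟩
      rw [this, Nat.add_sub_cancel] at h2
      exact Submodule.smul_mono le_rfl inf_le_right h2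
    have h3 : ∀ y ∈ a ^ s • I, ∀ hy : y ∈ I, g ⟨y, hy⟩ = 0 := by
      intro y hy
      induction hy using Submodule.smul_induction_on' with
      | smul r hr n hn =>
        intro hy
        have : (⟨r • n, hy⟩ : I) = r • ⟨n, hn⟩ := rfl
        rw [this, map_smul]
        exact hs r hr _ ⟨_, rfl⟩
      | add x hx y hy h1 h2 =>
        intro hxy
        have hxI : x ∈ I := Submodule.smul_le_right hx
        have hyI : y ∈ I := Submodule.smul_le_right hy
        have : (⟨x + y, hxy⟩ : I) = ⟨x, hxI⟩ + ⟨y, hyI⟩ := rfl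
        rw [this, map_add, h1, h2, add_zero]
    exact h3 x h1 hx
  let K : Submodule R I := Submodule.comap I.subtype (a ^ (s + k))
  let gb : (I ⧸ K) →ₗ[R] E := K.liftQ ((gammaSub a E).subtype ∘ₗ g) (by
    intro x hx
    simp only [LinearMap.mem_ker, LinearMap.comp_apply]
    rw [hle x.1 x.2 hx]; simp)
  let ι : (I ⧸ K) →ₗ[R] (R ⧸ a ^ (s + k)) := Submodule.mapQ K (a ^ (s + k)) I.subtype le_rfl
  have hι : Function.Injective ι := by
    rw [← LinearMap.ker_eq_bot, Submodule.ker_mapQ]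
    simp [K]
  obtain ⟨h, hh⟩ := hE.out ι hι gb
  refine ⟨(h.codRestrict (gammaSub a E) ?_) ∘ₗ Submodule.mkQ _, ?_⟩
  · intro y r hr
    refine (mem_rad_tors r _).2 ⟨s + k, ?_⟩
    rw [← map_smul]
    obtain ⟨y, rfl⟩ := Submodule.mkQ_surjective _ y
    rw [← map_smul]
    have : r ^ (s + k) • y ∈ a ^ (s + k) := Ideal.mul_mem_right _ _ (Ideal.pow_mem_pow hr _)
    rw [(Submodule.Quotient.mk_eq_zero _).2 this |> fun h => (show Submodule.mkQ _ _ = 0 from h), map_zero]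
  · intro x hx
    ext
    exact hh (Submodule.mkQ K ⟨x, hx⟩)

/-- the short complex of a submodule -/
def subSC {G : Type u} [AddCommGroup G] [Module R G] (N : Submodule R G) :
    ShortComplex (ModuleCat.{u} R) :=
  ShortComplex.mk (X₁ := ModuleCat.of R N) (X₂ := ModuleCat.of R G) (X₃ := ModuleCat.of R (G ⧸ N))
    (ModuleCat.ofHom N.subtype) (ModuleCat.ofHom N.mkQ)
    (by ext x; exact (Submodule.Quotient.mk_eq_zero N).2 x.2)

theorem subSC_exact {G : Type u} [AddCommGroup G] [Module R G] (N : Submodule R G) :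
    (subSC N).ShortExact := by
  refine ShortComplex.ShortExact.mk' ?_ ?_ ?_
  · rw [ShortComplex.moduleCat_exact_iff]
    intro x hx
    exact ⟨⟨x, (Submodule.Quotient.mk_eq_zero N).1 hx⟩, rfl⟩
  · rw [ModuleCat.mono_iff_injective]; exact N.injective_subtype
  · rw [ModuleCat.epi_iff_surjective]; exact N.mkQ_surjective

theorem Van.of_equiv {a : Ideal R} {i : ℕ} {N N' : ModuleCat.{u} R} (e : N ≅ N') (h : Van a i N) :
    Van a i N' := by
  intro t c
  obtain ⟨t', ht', h0⟩ := h t (c.comp (Abelian.Ext.mk₀ e.inv) (add_zero _))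
  refine ⟨t', ht', ?_⟩
  have h2 := congr($(h0).comp (Abelian.Ext.mk₀ e.hom) (add_zero _))
  simpa [Abelian.Ext.comp_assoc_of_third_deg_zero] using h2

theorem van_of_tors [IsNoetherianRing R] {a : Ideal R} (i : ℕ) (N : ModuleCat.{u} R)
    (hN : Tors a N) : Van a (i + 1) N := by
  -- embedding in an injective torsion module
  let E := Injective.under N
  have hE : Module.Injective R E :=
    (Module.injective_iff_injective_object R E).2 (inferInstanceAs (Injective (Injective.under N)))
  have hG := injective_gamma a E
  have hmono : Function.Injective (Injective.ι N).hom :=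
    (ModuleCat.mono_iff_injective (Injective.ι N)).1 inferInstance
  let j : N →ₗ[R] gammaSub a E := (Injective.ι N).hom.codRestrict _ (by
    intro u r hr
    obtain ⟨k, hk⟩ := (mem_rad_tors r u).1 (hN u hr)
    exact (mem_rad_tors r _).2 ⟨k, by rw [← map_smul, hk, map_zero]⟩)
  have hj : Function.Injective j := fun x y h => hmono (congrArg Subtype.val h)
  have hGi : Injective (ModuleCat.of R (gammaSub a E)) :=
    (Module.injective_iff_injective_object R _).1 hG
  let S := subSC (LinearMap.range j)
  have hS : S.ShortExact := subSC_exact _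
  have hX2 : Injective S.X₂ := hGi
  have e : S.X₁ ≅ N := (LinearEquiv.ofInjective j hj).symm.toModuleIso
  apply Van.of_equiv e
  have hQ : Tors a S.X₃ := (tors_gamma a E).of_surjective (Submodule.mkQ _)
    (Submodule.mkQ_surjective _)
  have h2 : ∀ i, Van a (i + 1) S.X₂ := fun i t c => ⟨t, le_rfl, by
    rw [Abelian.Ext.eq_zero_of_injective c]; simp⟩
  cases i with
  | succ i => exact Van.left hS (van_of_tors i _ hQ) (h2 _)
  | zero =>
    intro t c
    obtain ⟨d, hd⟩ := Abelian.Ext.covariant_sequence_exact₁ _ hS c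
      (Abelian.Ext.eq_zero_of_injective _) (n₀ := 0) rfl
    obtain ⟨f, rfl⟩ := Abelian.Ext.homEquiv₀.symm.surjective d
    obtain ⟨g, hg⟩ := (Submodule.mkQ_surjective (LinearMap.range j)) (f.hom (Submodule.Quotient.mk (1 : R)))
    obtain ⟨k, hk⟩ := (tors_gamma a E).exists_pow g
    let φ : ModuleCat.of R (R ⧸ a ^ (max t k)) ⟶ S.X₂ := ModuleCat.ofHom
      (Submodule.liftQ (a ^ max t k) (LinearMap.toSpanSingleton R _ g) (by
        intro r hr
        exact hk r (Ideal.pow_le_pow_right (le_max_right _ _) hr)))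
    have hφ : φ ≫ S.g = powProj a (le_max_left t k) ≫ f := by
      ext : 1
      apply Submodule.linearMap_qext
      apply LinearMap.ext_ring
      change Submodule.mkQ (LinearMap.range j) ((1 : R) • g) = f.hom (Submodule.Quotient.mk (1 : R))
      rw [one_smul, hg]
    refine ⟨max t k, le_max_left _ _, ?_⟩
    rw [← hd]
    change (Abelian.Ext.mk₀ _).comp ((Abelian.Ext.mk₀ f).comp _ _) _ = 0
    rw [Abelian.Ext.mk₀_comp_mk₀_assoc, ← hφ, ← Abelian.Ext.mk₀_comp_mk₀_assoc, hS.comp_extClass]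
    simp
termination_by i
end

section
variable {R : Type u} [CommRing R]

/-- the top Cech cohomology for `xs` of `N` vanishes -/
def TopV (xs : List R) (N : Type u) [AddCommGroup N] [Module R N] : Prop :=
  ∀ (u : N) (s : ℕ), ∃ k : ℕ, xs.prod ^ k • u ∈
    (Ideal.span {r | ∃ x ∈ xs, r = x ^ (k + s)}) • (⊤ : Submodule R N)

theorem smul_top_map_le {N C : Type u} [AddCommGroup N] [Module R N] [AddCommGroup C] [Module R C]
    (A : Set R) (ψ : N →ₗ[R] C) (W : Submodule R C) (h : ∀ r ∈ A, ∀ n, r • ψ n ∈ W) :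
    ∀ v ∈ Ideal.span A • (⊤ : Submodule R N), ψ v ∈ W := by
  intro v hv
  induction hv using Submodule.smul_induction_on' with
  | smul r hr n hn =>
    rw [map_smul]
    have : Ideal.span A ≤ Submodule.comap (LinearMap.toSpanSingleton R C (ψ n)) W := by
      apply Submodule.span_le.2
      intro r hr
      exact h r hr n
    exact this hr
  | add x hx y hy h1 h2 => rw [map_add]; exact W.add_mem h1 h2

theorem topV_coker {N L : Type u} [AddCommGroup N] [Module R N] [AddCommGroup L] [Module R L]
    (x : R) (xs : List R) (l : N →ₗ[R] L) (hb : Function.Bijective (fun u : L => x • u))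
    (hs : ∀ y : L, ∃ (p : ℕ) (n : N), x ^ p • y = l n) (h : TopV (x :: xs) N) :
    TopV xs (L ⧸ LinearMap.range l) := by
  have hb' : ∀ q : ℕ, Function.Bijective (LinearMap.lsmul R L (x ^ q)) := by
    intro q
    have : ⇑(LinearMap.lsmul R L (x ^ q)) = (fun u : L => x • u)^[q] := by
      rw [smul_iterate]; rfl
    rw [this]; exact hb.iterate q
  intro u s
  obtain ⟨y, rfl⟩ := Submodule.mkQ_surjective _ u
  obtain ⟨p, n, hpn⟩ := hs y
  obtain ⟨k, hk⟩ := h n (s + p)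
  refine ⟨k, ?_⟩
  let e := LinearEquiv.ofBijective _ (hb' (k + p))
  have he : ∀ z, e z = x ^ (k + p) • z := fun z => rfl
  let ψ : N →ₗ[R] L ⧸ LinearMap.range l := Submodule.mkQ _ ∘ₗ e.symm.toLinearMap ∘ₗ l
  have key := smul_top_map_le _ ψ (Ideal.span {r | ∃ x ∈ xs, r = x ^ (k + s)} •
    (⊤ : Submodule R (L ⧸ LinearMap.range l))) (by
      rintro r ⟨y, hy, rfl⟩ n'
      rcases List.mem_cons.1 hy with rfl | hy
      · have : y ^ (k + (s + p)) • ψ n' = 0 := by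
          have h1 : y ^ (k + (s + p)) • e.symm (l n') = l (y ^ s • n') := by
            rw [show k + (s + p) = s + (k + p) by omega, pow_add, mul_smul, ← he,
              e.apply_symm_apply, map_smul]
          change y ^ (k + (s + p)) • Submodule.mkQ _ (e.symm (l n')) = 0
          rw [← map_smul, h1]
          exact (Submodule.Quotient.mk_eq_zero _).2 ⟨_, rfl⟩
        rw [this]; exact Submodule.zero_mem _
      · rw [show k + (s + p) = p + (k + s) by omega, pow_add, mul_comm, mul_smul]
        exact Submodule.smul_mem_smul (Ideal.subset_span ⟨y, hy, rfl⟩) trivial) _ hk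
  have : ψ ((x :: xs).prod ^ k • n) = xs.prod ^ k • Submodule.mkQ _ y := by
    rw [map_smul, List.prod_cons, mul_pow, mul_comm, mul_smul]
    congr 1
    change x ^ k • Submodule.mkQ _ (e.symm (l n)) = _
    rw [← map_smul, ← hpn, ← map_smul e.symm, ← mul_smul, ← pow_add, ← he, e.symm_apply_apply]
  rwa [this] at key

theorem van_step [IsNoetherianRing R] {a : Ideal R} {N L : Type u} [AddCommGroup N] [Module R N]
    [AddCommGroup L] [Module R L] (x : R) (hx : x ∈ a) (l : N →ₗ[R] L)
    (hb : Function.Bijective (fun u : L => x • u)) (i : ℕ)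
    (hK : Van a (i + 1) (ModuleCat.of R (LinearMap.ker l)))
    (hC : Van a i (ModuleCat.of R (L ⧸ LinearMap.range l))) : Van a (i + 1) (ModuleCat.of R N) := by
  have h1 : Van a (i + 1) (ModuleCat.of R (LinearMap.range l)) :=
    Van.left (subSC_exact (LinearMap.range l)) hC (van_of_isUnit x hx hb _)
  refine Van.middle (subSC_exact (LinearMap.ker l)) hK ?_
  exact Van.of_equiv (l.quotKerEquivRange.symm.toModuleIso) h1

theorem van_cech [IsNoetherianRing R] {a : Ideal R} (xs : List R) (hxs : ∀ x ∈ xs, x ∈ a)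
    (b : Ideal R) (N : Type u) [AddCommGroup N] [Module R N] (hN : Tors b N)
    (hab : a ≤ b ⊔ Ideal.span {x | x ∈ xs}) :
    (∀ i, xs.length < i → Van a i (ModuleCat.of R N)) ∧
      (TopV xs N → Van a xs.length (ModuleCat.of R N)) := by
  induction xs generalizing b N with
  | nil =>
    have hab' : a ≤ b := by simpa using hab
    refine ⟨fun i hi => ?_, fun h => ?_⟩
    · obtain ⟨i, rfl⟩ := Nat.exists_eq_add_of_lt hi
      exact van_of_tors _ _ (fun u => hab'.trans (hN u))
    · have : Subsingleton N := subsingleton_of_forall_eq 0 fun u => by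
        obtain ⟨k, hk⟩ := h u 0
        simpa using hk
      exact van_of_subsingleton _
  | cons x xs ih =>
    have hxa : x ∈ a := hxs x (by simp)
    let L := LocalizedModule (Submonoid.powers x) N
    let l : N →ₗ[R] L := LocalizedModule.mkLinearMap _ _
    have hb : Function.Bijective (fun u : L => x • u) :=
      (Module.End.isUnit_iff _).1
        (IsLocalizedModule.map_units l (⟨x, Submonoid.mem_powers x⟩ : Submonoid.powers x))
    have hs : ∀ y : L, ∃ (p : ℕ) (n : N), x ^ p • y = l n := by
      intro y
      obtain ⟨⟨n, ⟨_, p, rfl⟩⟩, h⟩ := IsLocalizedModule.surj (Submonoid.powers x) l y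
      exact ⟨p, n, h⟩
    have hker : ∀ n, l n = 0 → ∃ k : ℕ, x ^ k • n = 0 := by
      intro n hn
      obtain ⟨⟨_, k, rfl⟩, h⟩ := (IsLocalizedModule.eq_zero_iff (Submonoid.powers x) l).1 hn
      exact ⟨k, h⟩
    have hinj : ∀ (q : ℕ) (z : L), x ^ q • z = 0 → z = 0 := by
      intro q z hz
      induction q with
      | zero => simpa using hz
      | succ q ihq =>
        apply ihq
        rw [pow_succ', mul_smul] at hz
        exact hb.1 (hz.trans (smul_zero x).symm)
    have hL : Tors b L := by
      intro y r hr
      obtain ⟨p, n, hp⟩ := hs y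
      obtain ⟨k, hk⟩ := (mem_rad_tors r n).1 (hN n hr)
      refine (mem_rad_tors r _).2 ⟨k, hinj p _ ?_⟩
      rw [smul_comm, hp, ← map_smul, hk, map_zero]
    have hK : Tors (b ⊔ Ideal.span {x}) (LinearMap.ker l) := by
      intro u
      refine sup_le ((hN.of_injective (LinearMap.ker l).subtype
        (Submodule.injective_subtype _)) u) ?_
      rw [Ideal.span_singleton_le_iff_mem]
      obtain ⟨k, hk⟩ := hker u.1 u.2
      exact (mem_rad_tors x u).2 ⟨k, Subtype.ext hk⟩
    have hC : Tors (b ⊔ Ideal.span {x}) (L ⧸ LinearMap.range l) := by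
      intro u
      refine sup_le ((hL.of_surjective (LinearMap.range l).mkQ
        (Submodule.mkQ_surjective _)) u) ?_
      rw [Ideal.span_singleton_le_iff_mem]
      obtain ⟨y, rfl⟩ := Submodule.mkQ_surjective _ u
      obtain ⟨p, n, hp⟩ := hs y
      refine (mem_rad_tors x _).2 ⟨p, ?_⟩
      rw [← map_smul, hp]
      exact (Submodule.Quotient.mk_eq_zero _).2 ⟨_, rfl⟩
    have hab' : a ≤ (b ⊔ Ideal.span {x}) ⊔ Ideal.span {x | x ∈ xs} := by
      refine hab.trans (le_of_eq ?_)
      rw [sup_assoc, ← Ideal.span_union]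
      congr 2; ext; simp
    have ihK := ih (fun y hy => hxs y (by simp [hy])) _ _ hK hab'
    have ihC := ih (fun y hy => hxs y (by simp [hy])) _ _ hC hab'
    refine ⟨fun i hi => ?_, fun h => ?_⟩
    · rw [List.length_cons] at hi
      obtain ⟨i, rfl⟩ : ∃ j, i = j + 1 := ⟨i - 1, by omega⟩
      exact van_step x hxa l hb i (ihK.1 _ (by omega)) (ihC.1 _ (by omega))
    · exact van_step x hxa l hb _ (ihK.1 _ (by simp)) (ihC.2 (topV_coker x xs l hb hs h))

/-- vanishing of the top local cohomology -/
theorem subsingleton_top [IsNoetherianRing R] {a : Ideal R} (xs : List R)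
    (hspan : Ideal.span {x | x ∈ xs} = a) (hn : xs ≠ []) (h : TopV xs R) :
    Subsingleton ((localCohomology a xs.length).obj (ModuleCat.of R R)) := by
  have h1 := (van_cech (a := a) xs (fun x hx => hspan ▸ Ideal.subset_span hx) ⊥ R
    (fun u => bot_le) (by rw [hspan]; exact le_sup_right)).2 h
  obtain ⟨y, ys, rfl⟩ := List.exists_cons_of_ne_nil hn
  exact subsingleton_localCohomology a _ _ h1
end

section

theorem pigeon {T ι : Type*} [CommRing T] [DecidableEq ι] (x : ι → T) (K : ℕ) (S : Finset ι) :
    (Ideal.span (x '' S)) ^ (S.card * K + 1) ≤ Ideal.span {r | ∃ j ∈ S, r = x j ^ K} := by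
  induction S using Finset.induction_on with
  | empty => simp
  | insert i S hi ih =>
    rw [Finset.card_insert_of_notMem hi, Finset.coe_insert, Set.image_insert_eq,
      Ideal.span_insert, show (S.card + 1) * K + 1 = K + (S.card * K + 1) by ring]
    refine Ideal.sup_pow_add_le_pow_sup_pow.trans (sup_le ?_ (ih.trans (Ideal.span_mono ?_)))
    · rw [Ideal.span_singleton_pow, Ideal.span_singleton_le_iff_mem]
      exact Ideal.subset_span ⟨i, by simp, rfl⟩
    · rintro r ⟨j, hj, rfl⟩
      exact ⟨j, by simp [hj], rfl⟩

theorem le_of_forall_maximal {T : Type*} [CommRing T] (Q L : Ideal T) (hQ : Q.FG)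
    (h : ∀ P : Ideal T, P.IsMaximal → Q ≤ L ⊔ P * Q) : Q ≤ L := by
  have : Submodule.colon L (Q : Set T) = ⊤ := by
    by_contra hne
    obtain ⟨P, hP, hle⟩ := Ideal.exists_le_maximal _ hne
    obtain ⟨r, hr, hrQ⟩ := Submodule.exists_sub_one_mem_and_smul_le_of_fg_of_le_sup hQ le_rfl (h P hP)
    have h1 : r ∈ P := hle (Submodule.mem_colon.2 fun q hq =>
      hrQ (Submodule.smul_mem_pointwise_smul q r Q hq))
    apply hP.ne_top
    rw [Ideal.eq_top_iff_one]
    simpa using P.sub_mem h1 hr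
  intro q hq
  have h1 : (1 : T) ∈ Submodule.colon L (Q : Set T) := by rw [this]; trivial
  simpa using Submodule.mem_colon.1 h1 q hq

theorem exists_exchange {T : Type*} [CommRing T] {n m : ℕ} (x : Fin n → T) (y : Fin m → T)
    (hxy : ∀ i, x i ∈ Ideal.span (Set.range y))
    (hyx : ∀ i, y i ∈ Ideal.span (Set.range x)) (hmn : m < n)
    (P : Ideal T) (hP : P.IsMaximal) : ∃ i, Ideal.span (Set.range x) ≤
      Ideal.span (x '' (Finset.univ.erase i : Finset (Fin n))) ⊔ P * Ideal.span (Set.range x) := by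
  choose B hB using fun i => Ideal.mem_span_range_iff_exists_fun.1 (hxy i)
  let : Field (T ⧸ P) := Ideal.Quotient.field P
  have hdep : ¬ LinearIndependent (T ⧸ P) (fun i => fun j => Ideal.Quotient.mk P (B i j)) := by
    intro h
    have := h.fintype_card_le_finrank
    simp at this
    omega
  obtain ⟨g, hg, i, hi⟩ := Fintype.not_linearIndependent_iff.1 hdep
  choose v hv using fun i => Ideal.Quotient.mk_surjective (g i)
  have h1 : ∑ i, v i * x i ∈ P * Ideal.span (Set.range x) := by
    have : ∑ i, v i * x i = ∑ j, (∑ i, v i * B i j) * y j := by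
      simp_rw [← hB, Finset.mul_sum, Finset.sum_mul]
      rw [Finset.sum_comm]
      simp_rw [mul_assoc]
    rw [this]
    refine Ideal.sum_mem _ fun j _ => Ideal.mul_mem_mul ?_ (hyx j)
    rw [← Ideal.Quotient.eq_zero_iff_mem, map_sum]
    have := congrFun hg j
    simpa [← hv] using this
  refine ⟨i, ?_⟩
  have hvi : v i ∉ P := by
    rwa [← Ideal.Quotient.eq_zero_iff_mem, hv]
  obtain ⟨d, p, hp, hd⟩ : ∃ d, ∃ p ∈ P, d * v i + p = 1 := by
    obtain ⟨d, hd⟩ := hP.exists_inv hvi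
    exact ⟨d, hd⟩
  have hvx : v i * x i ∈ Ideal.span (x '' (Finset.univ.erase i : Finset (Fin n))) ⊔
      P * Ideal.span (Set.range x) := by
    rw [← Finset.add_sum_erase _ _ (Finset.mem_univ i)] at h1
    have h2 : ∑ j ∈ Finset.univ.erase i, v j * x j ∈
        Ideal.span (x '' (Finset.univ.erase i : Finset (Fin n))) :=
      Ideal.sum_mem _ fun j hj => Ideal.mul_mem_left _ _ (Ideal.subset_span ⟨j, hj, rfl⟩)
    have := Ideal.sub_mem _ (Ideal.mem_sup_right (S := Ideal.span (x '' (Finset.univ.erase i : Finset (Fin n)))) h1) (Ideal.mem_sup_left h2)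
    simpa using this
  rw [Ideal.span_le]
  rintro _ ⟨j, rfl⟩
  by_cases hj : j = i
  · subst hj
    have : x j = d * (v j * x j) + p * x j := by rw [← mul_assoc, ← add_mul, hd, one_mul]
    rw [SetLike.mem_coe, this]
    exact Ideal.add_mem _ (Ideal.mul_mem_left _ _ hvx)
      (Ideal.mem_sup_right (Ideal.mul_mem_mul hp (Ideal.subset_span ⟨j, rfl⟩)))
  · exact Ideal.mem_sup_left (Ideal.subset_span ⟨j, by simpa using hj, rfl⟩)

theorem pow_le_exchange {T : Type*} [CommRing T] (I A P : Ideal T) (hA : A ≤ I)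
    (h : I ≤ A ⊔ P * I) (N : ℕ) : I ^ N ≤ A ^ N ⊔ P * I ^ N := by
  induction N with
  | zero => simp
  | succ N ih =>
    have hAN : A ^ N ≤ I ^ N := Ideal.pow_right_mono hA N
    calc I ^ (N+1) = I ^ N * I := pow_succ _ _
      _ ≤ (A ^ N ⊔ P * I ^ N) * I := Ideal.mul_mono_left ih
      _ = A ^ N * I ⊔ P * I ^ (N + 1) := by rw [Ideal.sup_mul, mul_assoc, ← pow_succ]
      _ ≤ A ^ N * (A ⊔ P * I) ⊔ P * I ^ (N + 1) := sup_le_sup_right (Ideal.mul_mono_right h) _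
      _ ≤ A ^ (N+1) ⊔ P * I ^ (N + 1) := by
        rw [Ideal.mul_sup, ← pow_succ]
        refine sup_le (sup_le le_sup_left (le_sup_of_le_right ?_)) le_sup_right
        rw [mul_left_comm, pow_succ]
        exact Ideal.mul_mono_right (Ideal.mul_mono_left hAN)

theorem pow_le_span_pow {T : Type*} [CommRing T] {n m : ℕ} (x : Fin n → T) (y : Fin m → T)
    (hxy : Ideal.span (Set.range x) = Ideal.span (Set.range y)) (hmn : m < n) (K : ℕ) :
    Ideal.span (Set.range x) ^ ((n - 1) * K + 1) ≤ Ideal.span (Set.range fun i => x i ^ K) := by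
  apply le_of_forall_maximal
  · exact (Submodule.fg_span (Set.finite_range x)).pow _
  intro P hP
  obtain ⟨i, hi⟩ := exists_exchange x y (fun i => hxy ▸ Ideal.subset_span ⟨i, rfl⟩)
    (fun i => hxy ▸ Ideal.subset_span ⟨i, rfl⟩) hmn P hP
  refine (pow_le_exchange _ _ P (Ideal.span_mono (Set.image_subset_range _ _)) hi _).trans
    (sup_le_sup_right ?_ _)
  have := pigeon x K (Finset.univ.erase i)
  rw [Finset.card_erase_of_mem (Finset.mem_univ i), Finset.card_univ, Fintype.card_fin] at this
  refine this.trans (Ideal.span_mono ?_)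
  rintro _ ⟨j, -, rfl⟩
  exact ⟨j, rfl⟩

theorem IsPureAlgebra.mem_of_mem_map {R T : Type u} [CommRing R] [CommRing T] [Algebra R T]
    (hpure : IsPureAlgebra R T) (L : Ideal R) (r : R)
    (hr : algebraMap R T r ∈ L.map (algebraMap R T)) : r ∈ L := by
  let φ : T →ₗ[T] T ⊗[R] (R ⧸ L) := LinearMap.toSpanSingleton T _ (1 ⊗ₜ Submodule.Quotient.mk 1)
  have hφ : ∀ s : R, φ (algebraMap R T s) = 1 ⊗ₜ Submodule.Quotient.mk s := by
    intro s
    change algebraMap R T s • ((1 : T) ⊗ₜ[R] (Submodule.Quotient.mk 1 : R ⧸ L)) = _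
    rw [algebraMap_smul, ← TensorProduct.tmul_smul, ← Submodule.Quotient.mk_smul, smul_eq_mul,
      mul_one]
  have h1 : L.map (algebraMap R T) ≤ LinearMap.ker φ := by
    rw [Ideal.map_le_iff_le_comap]
    intro s hs
    change φ _ = 0
    rw [hφ, (Submodule.Quotient.mk_eq_zero L).2 hs, TensorProduct.tmul_zero]
  have h2 := h1 hr
  rw [LinearMap.mem_ker, hφ] at h2
  have := hpure (R ⧸ L) (a₁ := Submodule.Quotient.mk r) (a₂ := 0) (by simpa using h2)
  exact (Submodule.Quotient.mk_eq_zero L).1 this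

theorem topV_of_few {R T : Type u} [CommRing R] [CommRing T] [Algebra R T]
    (hpure : IsPureAlgebra R T) (a : Ideal R) (xs : List R) (hxs : Ideal.span {x | x ∈ xs} = a)
    (ys : List T) (hys : Ideal.span {y | y ∈ ys} = a.map (algebraMap R T))
    (hlt : ys.length < xs.length) : TopV xs R := by
  intro u s
  let n := xs.length
  let k := (n - 1) * s + 1
  refine ⟨k, ?_⟩
  let x : Fin n → T := fun i => algebraMap R T (xs.get i)
  have hx : Ideal.span (Set.range x) = a.map (algebraMap R T) := by
    rw [← hxs, Ideal.map_span]
    congr 1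
    ext z
    simp only [x, Set.mem_range, Set.mem_image, Set.mem_ofPred_eq, List.mem_iff_get]
    constructor
    · rintro ⟨i, rfl⟩; exact ⟨_, ⟨i, rfl⟩, rfl⟩
    · rintro ⟨_, ⟨i, rfl⟩, rfl⟩; exact ⟨i, rfl⟩
  have hy : Ideal.span (Set.range ys.get) = a.map (algebraMap R T) := by
    rw [← hys, Set.range_list_get]
  have key := pow_le_span_pow x ys.get (hx.trans hy.symm) hlt (k + s)
  have hN : (n - 1) * (k + s) + 1 ≤ n * k := by
    obtain ⟨n', hn'⟩ : ∃ n', n = n' + 1 := ⟨n - 1, by omega⟩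
    simp only [k, hn', Nat.add_sub_cancel]
    ring_nf; omega
  have h1 : xs.prod ^ k ∈ a ^ (n * k) := by
    rw [pow_mul]
    apply Ideal.pow_mem_pow
    have : ∀ l : List R, (∀ z ∈ l, z ∈ a) → l.prod ∈ a ^ l.length := by
      intro l
      induction l with
      | nil => simp
      | cons z l ih =>
        intro h
        rw [List.prod_cons, List.length_cons, pow_succ']
        exact Ideal.mul_mem_mul (h z (by simp)) (ih fun w hw => h w (by simp [hw]))
    exact this xs (fun z hz => hxs ▸ Ideal.subset_span hz)
  have h2 : xs.prod ^ k ∈ Ideal.span {r | ∃ x ∈ xs, r = x ^ (k + s)} := by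
    apply hpure.mem_of_mem_map
    have h4 : algebraMap R T (xs.prod ^ k) ∈ Ideal.span (Set.range x) ^ (n * k) := by
      rw [hx, ← Ideal.map_pow]; exact Ideal.mem_map_of_mem _ h1
    have h3 := key (Ideal.pow_le_pow_right hN h4)
    refine (Ideal.span_le.2 ?_ : _ ≤ Ideal.map (algebraMap R T) _) h3
    rintro _ ⟨i, rfl⟩
    have := Ideal.mem_map_of_mem (algebraMap R T)
      (Ideal.subset_span ⟨xs.get i, List.get_mem _ _, rfl⟩ :
        (xs.get i) ^ (k + s) ∈ Ideal.span {r | ∃ x ∈ xs, r = x ^ (k + s)})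
    rwa [map_pow] at this
  exact Submodule.smul_mem_smul h2 trivial
end

section

/-- vanishing of `Ext^i(T/I, W)` for `i < n` -/
def ExtVan {T : Type u} [CommRing T] (I : Ideal T) (W : ModuleCat.{u} T) (n : ℕ) : Prop :=
  ∀ i, i < n → ∀ c : Abelian.Ext.{u} (ModuleCat.of T (T ⧸ I)) W i, c = 0

theorem ExtVan.quot {T : Type u} [CommRing T] {I : Ideal T} {n : ℕ}
    {S : ShortComplex (ModuleCat.{u} T)} (hS : S.ShortExact) (h1 : ExtVan I S.X₁ (n + 1))
    (h2 : ExtVan I S.X₂ (n + 1)) : ExtVan I S.X₃ n := by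
  intro i hi c
  obtain ⟨d, rfl⟩ := Abelian.Ext.covariant_sequence_exact₃ _ hS c rfl (h1 _ (by omega) _)
  rw [h2 i (by omega) d, Abelian.Ext.zero_comp]

theorem extVan_of_isWeaklyRegular {T : Type u} [CommRing T] {I : Ideal T} (ys : List T)
    (hys : ∀ y ∈ ys, y ∈ I) (W : Type u) [AddCommGroup W] [Module T W]
    (h : RingTheory.Sequence.IsWeaklyRegular W ys) : ExtVan I (ModuleCat.of T W) ys.length := by
  induction ys generalizing W with
  | nil => intro i hi; simp at hi
  | cons y ys ih =>
    rw [RingTheory.Sequence.isWeaklyRegular_cons_iff] at h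
    have ih' := ih (fun z hz => hys z (by simp [hz])) _ h.2
    have hy := hys y (by simp)
    have hann : ∀ t : T ⧸ I, y • t = 0 := by
      intro t
      obtain ⟨t, rfl⟩ := Ideal.Quotient.mk_surjective t
      change Ideal.Quotient.mk I (y * t) = 0
      rw [Ideal.Quotient.eq_zero_iff_mem]
      exact Ideal.mul_mem_right _ _ hy
    have hS := IsSMulRegular.smulShortComplex_shortExact (M := ModuleCat.of T W) h.1
    intro i hi c
    have h0 := ext_smul_eq_zero (X := ModuleCat.of T (T ⧸ I)) y hann c
    cases i with
    | zero =>
      obtain ⟨f, rfl⟩ := Abelian.Ext.homEquiv₀.symm.surjective c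
      have hf : f = 0 := by
        refine ModuleCat.hom_ext (LinearMap.ext fun t => ?_)
        have h3 : y • f.hom t = 0 := by rw [← map_smul, hann t, map_zero]
        exact h.1 (h3.trans (smul_zero y).symm)
      subst hf
      exact Abelian.Ext.mk₀_zero _ _
    | succ i =>
      obtain ⟨d, rfl⟩ := Abelian.Ext.covariant_sequence_exact₁ _ hS c h0 rfl
      have hd : d = 0 := ih' i (by simpa using hi) d
      rw [hd, Abelian.Ext.zero_comp]
      rfl

theorem ExtVan.not_le {T : Type u} [CommRing T] [IsNoetherianRing T] {I : Ideal T} {n : ℕ}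
    (W : Type u) [AddCommGroup W] [Module T W] (h : ExtVan I (ModuleCat.of T W) (n + 1))
    (p : Ideal T) (hp : p ∈ associatedPrimes T W) : ¬ I ≤ p := by
  intro hle
  obtain ⟨hpp, w, rfl⟩ := isAssociatedPrime_iff.1 (AssociatedPrimes.mem_iff.1 hp)
  let f : ModuleCat.of T (T ⧸ I) ⟶ ModuleCat.of T W := ModuleCat.ofHom
    (Submodule.liftQ I (LinearMap.toSpanSingleton T W w) (by
      intro r hr
      have := hle hr
      rw [Submodule.mem_colon_singleton] at this
      simpa using this))
  have h0 := h 0 (by omega) (Abelian.Ext.mk₀ f)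
  have hf : f = 0 := Abelian.Ext.homEquiv₀.symm.injective (h0.trans (Abelian.Ext.mk₀_zero _ _).symm)
  have hw : w = 0 := by
    have h1 : f.hom (Submodule.Quotient.mk (1 : T)) = 0 := by rw [hf]; rfl
    have h2 : f.hom (Submodule.Quotient.mk (1 : T)) = (1 : T) • w := rfl
    rw [h2, one_smul] at h1
    exact h1
  apply hpp.ne_top
  subst hw
  simp

theorem coset_avoid {R : Type*} [CommRing R] (x : R) (J : Ideal R) (S : Finset (Ideal R))
    (hS : ∀ P ∈ S, P.IsPrime ∧ ¬ Ideal.span {x} ⊔ J ≤ P) : ∃ j ∈ J, ∀ P ∈ S, x + j ∉ P := by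
  classical
  induction hn : S.card generalizing S with
  | zero =>
    rw [Finset.card_eq_zero] at hn
    subst hn
    exact ⟨0, J.zero_mem, by simp⟩
  | succ n ih =>
    obtain ⟨P, hPm⟩ := Finset.exists_minimal (s := S) (Finset.card_pos.1 (by omega))
    have hP := hPm.1
    obtain ⟨j, hj, hjS⟩ := ih (S.erase P) (fun Q hQ => hS Q (Finset.mem_of_mem_erase hQ))
      (by rw [Finset.card_erase_of_mem hP]; omega)
    by_cases hy : x + j ∈ P
    · have hPp := (hS P hP).1
      have hJP : ¬ J ≤ P := by
        intro hle
        apply (hS P hP).2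
        refine sup_le ?_ hle
        rw [Ideal.span_singleton_le_iff_mem]
        simpa using P.sub_mem hy (hle hj)
      have hnot : ¬ (J * ∏ Q ∈ S.erase P, Q) ≤ P := by
        rw [hPp.mul_le]
        push Not
        refine ⟨hJP, ?_⟩
        intro hle
        obtain ⟨Q, hQ, hQP⟩ := (hPp.prod_le (f := fun Q => Q)).1 hle
        have h1 := hPm.2 (Finset.mem_of_mem_erase hQ) hQP
        exact (Finset.mem_erase.1 hQ).1 (le_antisymm hQP h1)
      obtain ⟨w, hw, hwP⟩ := SetLike.not_le_iff_exists.1 hnot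
      have hgen : ∀ A : Ideal R, w ∈ J * A → w ∈ J ∧ w ∈ A := fun A hA =>
        Ideal.mem_inf.1 (Ideal.mul_le_inf hA)
      have hw2 := hgen _ hw
      refine ⟨j + w, J.add_mem hj hw2.1, fun Q hQ hmem => ?_⟩
      by_cases hQP : Q = P
      · subst hQP
        apply hwP
        have := Q.sub_mem hmem hy
        rwa [← add_assoc, add_sub_cancel_left] at this
      · have hQe : Q ∈ S.erase P := Finset.mem_erase.2 ⟨hQP, hQ⟩
        apply hjS Q hQe
        have hwQ : w ∈ Q := by
          have h2 : ∏ Q ∈ S.erase P, Q ≤ Q := by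
            refine Ideal.prod_le_inf.trans ?_
            exact Finset.inf_le (f := fun Q => Q) hQe
          exact h2 hw2.2
        have := Q.sub_mem hmem hwQ
        rwa [← add_assoc, add_sub_cancel_right] at this
    · refine ⟨j, hj, fun Q hQ => ?_⟩
      by_cases hQP : Q = P
      · rwa [hQP]
      · exact hjS Q (Finset.mem_erase.2 ⟨hQP, hQ⟩)

section
variable {R T : Type u} [CommRing R] [CommRing T] [Algebra R T] 

theorem isSMulRegular_of_avoid [IsNoetherianRing T] (N : Type u) [AddCommGroup N] [Module R N] (z : R)
    (h : ∀ p ∈ associatedPrimes T (T ⊗[R] N), z ∉ p.comap (algebraMap R T)) :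
    IsSMulRegular (T ⊗[R] N) (algebraMap R T z) := by
  by_contra hne
  have : algebraMap R T z ∈ ⋃ p ∈ associatedPrimes T (T ⊗[R] N), (p : Set T) := by
    rw [biUnion_associatedPrimes_eq_compl_regular]; exact hne
  simp only [Set.mem_iUnion] at this
  obtain ⟨p, hp, hz⟩ := this
  exact h p hp hz

theorem IsPureAlgebra.isSMulRegular (hpure : IsPureAlgebra R T) (N : Type u) [AddCommGroup N]
    [Module R N] (z : R) (h : IsSMulRegular (T ⊗[R] N) (algebraMap R T z)) : IsSMulRegular N z := by
  intro n n' hn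
  apply hpure N
  apply h
  simp only [algebraMap_smul, ← TensorProduct.tmul_smul]
  exact congrArg _ hn

/-- base change of multiplication by `z`. -/
def bcSC (T : Type u) [CommRing T] [Algebra R T] (N : Type u) [AddCommGroup N] [Module R N] (z : R) :
    ShortComplex (ModuleCat.{u} T) :=
  ShortComplex.mk (X₁ := ModuleCat.of T (T ⊗[R] N)) (X₂ := ModuleCat.of T (T ⊗[R] N))
    (X₃ := ModuleCat.of T (T ⊗[R] QuotSMulTop z N))
    (ModuleCat.ofHom (LinearMap.baseChange T (LinearMap.lsmul R N z)))
    (ModuleCat.ofHom (LinearMap.baseChange T (Submodule.mkQ (z • (⊤ : Submodule R N))))) (by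
      rw [← ModuleCat.ofHom_comp, ← LinearMap.baseChange_comp]
      have : Submodule.mkQ (z • (⊤ : Submodule R N)) ∘ₗ (LinearMap.lsmul R N z) = 0 := by
        ext n
        exact (Submodule.Quotient.mk_eq_zero _).2 (Submodule.smul_mem_pointwise_smul n z ⊤ trivial)
      rw [this, LinearMap.baseChange_zero]; rfl)

theorem bcSC_exact (N : Type u) [AddCommGroup N] [Module R N] (z : R)
    (h : IsSMulRegular (T ⊗[R] N) (algebraMap R T z)) : (bcSC T N z).ShortExact := by
  refine ShortComplex.ShortExact.mk' ?_ ?_ ?_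
  · rw [ShortComplex.moduleCat_exact_iff]
    intro x hx
    have hex : Function.Exact (LinearMap.lsmul R N z) (Submodule.mkQ (z • (⊤ : Submodule R N))) := by
      intro n
      rw [Submodule.mkQ_apply, Submodule.Quotient.mk_eq_zero]
      constructor
      · intro hn
        obtain ⟨m, -, hm⟩ := hn
        exact ⟨m, hm⟩
      · rintro ⟨m, rfl⟩
        exact Submodule.smul_mem_pointwise_smul m z ⊤ trivial
    exact (lTensor_exact T hex (Submodule.mkQ_surjective _) x).1 hx
  · rw [ModuleCat.mono_iff_injective]
    have : ∀ w : T ⊗[R] N, LinearMap.baseChange T (LinearMap.lsmul R N z) w = algebraMap R T z • w := by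
      intro w
      induction w using TensorProduct.induction_on with
      | zero => simp
      | tmul t n => simp [algebraMap_smul]
      | add x y hx hy => rw [map_add, hx, hy, smul_add]
    intro w w' hw
    exact h ((this w).symm.trans (hw.trans (this w')))
  · rw [ModuleCat.epi_iff_surjective]
    exact LinearMap.lTensor_surjective T (Submodule.mkQ_surjective _)

theorem annih_quot (N : Type u) [AddCommGroup N] [Module R N] (z x : R) (J a : Ideal R) (hzx : z - x ∈ J)
    (h : a ≤ (Ideal.span {x} ⊔ J) ⊔ Module.annihilator R N) :
    a ≤ J ⊔ Module.annihilator R (QuotSMulTop z N) := by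
  have hz : z ∈ Module.annihilator R (QuotSMulTop z N) := by
    rw [Module.mem_annihilator]
    intro m
    obtain ⟨m, rfl⟩ := Submodule.mkQ_surjective _ m
    rw [← map_smul]
    exact (Submodule.Quotient.mk_eq_zero _).2 (Submodule.smul_mem_pointwise_smul m z ⊤ trivial)
  refine h.trans (sup_le (sup_le ?_ le_sup_left) (le_sup_of_le_right ?_))
  · rw [Ideal.span_singleton_le_iff_mem]
    have : x = - (z - x) + z := by ring
    rw [this]
    exact Ideal.add_mem _ (Ideal.mem_sup_left (J.neg_mem hzx)) (Ideal.mem_sup_right hz)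
  · exact LinearMap.annihilator_le_of_surjective (Submodule.mkQ (z • (⊤ : Submodule R N)))
      (Submodule.mkQ_surjective _)

theorem not_le_contract [IsNoetherianRing T] {n : ℕ} {a J : Ideal R} (N : Type u) [AddCommGroup N]
    [Module R N] (h : ExtVan (a.map (algebraMap R T)) (ModuleCat.of T (T ⊗[R] N)) (n + 1))
    (haJ : a ≤ J ⊔ Module.annihilator R N) (p : Ideal T) (hp : p ∈ associatedPrimes T (T ⊗[R] N)) :
    ¬ J ≤ p.comap (algebraMap R T) := by
  intro hle
  apply h.not_le _ p hp
  rw [Ideal.map_le_iff_le_comap]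
  refine haJ.trans (sup_le hle ?_)
  intro r hr
  have h1 := (AssociatedPrimes.mem_iff.1 hp).annihilator_le
  apply h1
  rw [Submodule.annihilator_top]
  rw [Module.mem_annihilator] at hr ⊢
  intro w
  induction w using TensorProduct.induction_on with
  | zero => simp
  | tmul t n => rw [algebraMap_smul, ← TensorProduct.tmul_smul, hr, TensorProduct.tmul_zero]
  | add x y hx hy => rw [smul_add, hx, hy, add_zero]

theorem exists_regular_s4 [IsNoetherianRing T] (hpure : IsPureAlgebra R T)
    (a : Ideal R) (xs : List R) (hxs : ∀ x ∈ xs, x ∈ a)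
    (N₁ N₂ : Type u) [AddCommGroup N₁] [Module R N₁] [Module.Finite R N₁]
    [AddCommGroup N₂] [Module R N₂] [Module.Finite R N₂]
    (h₁ : ExtVan (a.map (algebraMap R T)) (ModuleCat.of T (T ⊗[R] N₁)) xs.length)
    (h₂ : ExtVan (a.map (algebraMap R T)) (ModuleCat.of T (T ⊗[R] N₂)) xs.length)
    (ha₁ : a ≤ Ideal.span {x | x ∈ xs} ⊔ Module.annihilator R N₁)
    (ha₂ : a ≤ Ideal.span {x | x ∈ xs} ⊔ Module.annihilator R N₂) :
    ∃ rs : List R, rs.length = xs.length ∧ Ideal.span {x | x ∈ rs} = Ideal.span {x | x ∈ xs} ∧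
      RingTheory.Sequence.IsWeaklyRegular N₁ rs ∧ RingTheory.Sequence.IsWeaklyRegular N₂ rs := by
  classical
  induction xs generalizing N₁ N₂ with
  | nil => exact ⟨[], rfl, rfl, RingTheory.Sequence.IsWeaklyRegular.nil R N₁,
      RingTheory.Sequence.IsWeaklyRegular.nil R N₂⟩
  | cons x xs ih =>
    have hcons : ∀ (y : R) (l : List R),
        Ideal.span {w | w ∈ y :: l} = Ideal.span {y} ⊔ Ideal.span {w | w ∈ l} := by
      intro y l
      rw [← Ideal.span_union]
      congr 1; ext; simp
    set J := Ideal.span {w | w ∈ xs} with hJ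
    rw [hcons] at ha₁ ha₂
    have f₁ := associatedPrimes.finite T (T ⊗[R] N₁)
    have f₂ := associatedPrimes.finite T (T ⊗[R] N₂)
    obtain ⟨j, hj, hav⟩ := coset_avoid x J
      ((f₁.toFinset ∪ f₂.toFinset).image (fun p => p.comap (algebraMap R T))) (by
        intro P hP
        obtain ⟨p, hp, rfl⟩ := Finset.mem_image.1 hP
        rcases Finset.mem_union.1 hp with hp | hp
        · have hp' := f₁.mem_toFinset.1 hp
          have := (AssociatedPrimes.mem_iff.1 hp').isPrime
          exact ⟨Ideal.comap_isPrime _ _, not_le_contract N₁ h₁ ha₁ p hp'⟩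
        · have hp' := f₂.mem_toFinset.1 hp
          have := (AssociatedPrimes.mem_iff.1 hp').isPrime
          exact ⟨Ideal.comap_isPrime _ _, not_le_contract N₂ h₂ ha₂ p hp'⟩)
    have r₁ : IsSMulRegular (T ⊗[R] N₁) (algebraMap R T (x + j)) :=
      isSMulRegular_of_avoid N₁ (x + j) fun p hp => hav _ (Finset.mem_image_of_mem _
        (Finset.mem_union_left _ (f₁.mem_toFinset.2 hp)))
    have r₂ : IsSMulRegular (T ⊗[R] N₂) (algebraMap R T (x + j)) :=
      isSMulRegular_of_avoid N₂ (x + j) fun p hp => hav _ (Finset.mem_image_of_mem _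
        (Finset.mem_union_right _ (f₂.mem_toFinset.2 hp)))
    have hzx : (x + j) - x ∈ J := by simpa using hj
    obtain ⟨rs, hlen, hspan, w₁, w₂⟩ := ih (fun y hy => hxs y (by simp [hy]))
      (QuotSMulTop (x + j) N₁) (QuotSMulTop (x + j) N₂)
      (ExtVan.quot (bcSC_exact N₁ _ r₁) h₁ h₁) (ExtVan.quot (bcSC_exact N₂ _ r₂) h₂ h₂)
      (annih_quot N₁ _ x J a hzx ha₁) (annih_quot N₂ _ x J a hzx ha₂)
    refine ⟨(x + j) :: rs, by simp [hlen], ?_, ?_, ?_⟩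
    · rw [hcons, hcons, hspan]
      apply le_antisymm
      · refine sup_le ?_ le_sup_right
        rw [Ideal.span_singleton_le_iff_mem]
        exact Ideal.add_mem _ (Ideal.mem_sup_left (Ideal.mem_span_singleton_self x))
          (Ideal.mem_sup_right hj)
      · refine sup_le ?_ le_sup_right
        rw [Ideal.span_singleton_le_iff_mem]
        have := Ideal.sub_mem (Ideal.span {x + j} ⊔ J)
          (Ideal.mem_sup_left (Ideal.mem_span_singleton_self (x + j))) (Ideal.mem_sup_right hj)
        simpa using this
    · exact (RingTheory.Sequence.isWeaklyRegular_cons_iff _ _ _).2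
        ⟨hpure.isSMulRegular N₁ _ r₁, w₁⟩
    · exact (RingTheory.Sequence.isWeaklyRegular_cons_iff _ _ _).2
        ⟨hpure.isSMulRegular N₂ _ r₂, w₂⟩
end
end

section
theorem smul_top_of_pure {R T : Type u} [CommRing R] [CommRing T] [Algebra R T]
    (hpure : IsPureAlgebra R T) (a : Ideal R) (M : Type u) [AddCommGroup M] [Module R M]
    (h : a.map (algebraMap R T) • (⊤ : Submodule T (T ⊗[R] M)) = ⊤) :
    a • (⊤ : Submodule R M) = ⊤ := by
  let N := M ⧸ (a • (⊤ : Submodule R M))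
  let φ : T ⊗[R] M →ₗ[T] T ⊗[R] N := LinearMap.baseChange T (Submodule.mkQ _)
  have hann : a.map (algebraMap R T) ≤ Module.annihilator T (T ⊗[R] N) := by
    rw [Ideal.map_le_iff_le_comap]
    intro r hr
    rw [Ideal.mem_comap, Module.mem_annihilator]
    intro w
    induction w using TensorProduct.induction_on with
    | zero => simp
    | tmul t n =>
      obtain ⟨m, rfl⟩ := Submodule.mkQ_surjective _ n
      rw [algebraMap_smul, ← TensorProduct.tmul_smul, ← map_smul, Submodule.mkQ_apply,
        (Submodule.Quotient.mk_eq_zero _).2 (Submodule.smul_mem_smul hr (Submodule.mem_top : m ∈ ⊤)),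
        TensorProduct.tmul_zero]
    | add x y hx hy => rw [smul_add, hx, hy, add_zero]
  have h0 : ∀ w ∈ a.map (algebraMap R T) • (⊤ : Submodule T (T ⊗[R] M)), φ w = 0 := by
    intro w hw
    induction hw using Submodule.smul_induction_on' with
    | smul r hr n hn => rw [map_smul]; exact Module.mem_annihilator.1 (hann hr) _
    | add x hx y hy h1 h2 => rw [map_add, h1, h2, add_zero]
  rw [eq_top_iff]
  intro m _
  have h1 : φ (1 ⊗ₜ m) = 0 := h0 _ (by rw [h]; trivial)
  have h2 : (Submodule.Quotient.mk m : N) = 0 := hpure N (h1.trans (TensorProduct.tmul_zero _ _).symm)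
  exact (Submodule.Quotient.mk_eq_zero _).1 h2

theorem nontrivial_of_cohDim {R : Type u} [CommRing R] (a : Ideal R) (n : ℕ)
    (h : cohDim a R = ((n + 1 : ℕ) : ℕ∞)) :
    Nontrivial ((localCohomology a (n + 1)).obj (ModuleCat.of R R)) := by
  by_contra hne
  have hle : cohDim a R ≤ (n : ℕ∞) := by
    apply sSup_le
    rintro _ ⟨i, hi, rfl⟩
    have h1 : (i : ℕ∞) ≤ ((n + 1 : ℕ) : ℕ∞) := h ▸ le_sSup ⟨i, hi, rfl⟩
    have h2 : i ≤ n + 1 := by exact_mod_cast h1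
    have h3 : i ≠ n + 1 := by
      rintro rfl
      exact hne hi
    have h4 : i ≤ n := by omega
    change (i : ℕ∞) ≤ (n : ℕ∞)
    exact_mod_cast h4
  rw [h] at hle
  have : n + 1 ≤ n := by exact_mod_cast hle
  omega

theorem exists_idealMu {R : Type u} [CommRing R] [IsNoetherianRing R] (a : Ideal R) :
    ∃ xs : List R, (xs.length : ℕ∞) = idealMu a ∧ Ideal.span {x | x ∈ xs} = a := by
  obtain ⟨s, hs⟩ := IsNoetherian.noetherian a
  obtain ⟨n, ⟨s, hs, hspan⟩, hn⟩ := csInf_mem (s := (fun n : ℕ => (n : ℕ∞)) ''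
    {n : ℕ | ∃ s : Finset R, s.card = n ∧ Ideal.span (s : Set R) = a}) ⟨_, _, ⟨s, rfl, hs⟩, rfl⟩
  refine ⟨s.toList, ?_, ?_⟩
  · rw [Finset.length_toList, hs]; exact hn
  · rw [← hspan]; congr 1; ext; simp
end

end helpers

theorem stmt4 {R T : Type u} [CommRing R] [CommRing T] [Algebra R T]
    [IsNoetherianRing R] [IsNoetherianRing T]
    (hpure : IsPureAlgebra R T) (a : Ideal R) (ha : a ≠ ⊤)
    (hjac : a ≤ (⊥ : Ideal R).jacobson) (hmu : idealMu a = cohDim a R)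
    (M : Type u) [AddCommGroup M] [Module R M] [Module.Finite R M]
    (h : IsRelRegular (a.map (algebraMap R T)) (T ⊗[R] M)) :
    IsRelRegular a M := by
  by_cases haM : a • (⊤ : Submodule R M) = ⊤
  · exact Or.inl haM
  rcases h with h | ⟨-, ys, -, hys, hreg, hregT⟩
  · exact Or.inl (smul_top_of_pure hpure a M h)
  right
  refine ⟨haM, ?_⟩
  obtain ⟨xs, hlen, hspan⟩ := exists_idealMu a
  have hle : xs.length ≤ ys.length := by
    by_contra hlt
    rw [not_le] at hlt
    have htop := topV_of_few hpure a xs hspan ys hys hlt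
    have hne : xs ≠ [] := by rintro rfl; simp at hlt
    have hsub := subsingleton_top xs hspan hne htop
    obtain ⟨n, hn⟩ : ∃ n, xs.length = n + 1 := ⟨xs.length - 1, by omega⟩
    have hnt := nontrivial_of_cohDim a n (by rw [← hmu, ← hlen, hn])
    rw [hn] at hsub
    exact not_subsingleton _ hsub
  have hysmem : ∀ y ∈ ys, y ∈ a.map (algebraMap R T) := fun y hy => hys ▸ Ideal.subset_span hy
  have e1 := extVan_of_isWeaklyRegular ys hysmem (T ⊗[R] M) hreg.1
  have e2 := extVan_of_isWeaklyRegular ys hysmem (T ⊗[R] R)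
    (((TensorProduct.AlgebraTensorModule.rid R T T).isWeaklyRegular_congr ys).2 hregT.1)
  obtain ⟨rs, hrl, hrspan, w1, w2⟩ := exists_regular_s4 hpure a xs
    (fun x hx => hspan ▸ Ideal.subset_span hx) M R
    (fun i hi => e1 i (by omega)) (fun i hi => e2 i (by omega))
    (by rw [hspan]; exact le_sup_left) (by rw [hspan]; exact le_sup_left)
  have hra : Ideal.span {x | x ∈ rs} = a := hrspan.trans hspan
  refine ⟨rs, by rw [hrl, hlen, hmu], hra, ⟨w1, ?_⟩, ⟨w2, ?_⟩⟩
  · intro h0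
    apply haM
    rw [← hra]; exact h0.symm
  · intro h0
    apply ha
    have : Ideal.ofList rs = a := hra
    rw [this] at h0
    rw [h0, smul_eq_mul, Ideal.mul_top]

end
end

section
/- Let f : (R, 𝔪) → (T, 𝔫) be a pure local ring homomorphism with Rad(𝔪T) = 𝔫, and M a finitely generated R-module. Then dim_T(T ⊗_R M) = dim_R M; moreover, if T ⊗_R M is a Cohen-Macaulay T-module, then M is a Cohen-Macaulay R-module. -/
open CategoryTheory TensorProduct

noncomputable section

universe u

/-- The Krull dimension of a module, `dim (R ⧸ Ann M)`. -/
noncomputable def moduleKrullDim (R : Type u) [CommRing R]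
    (M : Type u) [AddCommGroup M] [Module R M] : WithBot ℕ∞ :=
  ringKrullDim (R ⧸ Module.annihilator R M)

/-- `M` is a Cohen-Macaulay module over the local ring `R`: `M = 0` or `depth M = dim M`,
where `depth M = grade(𝔪, M)`. -/
def IsCMModule (R : Type u) [CommRing R] [IsLocalRing R]
    (M : Type u) [AddCommGroup M] [Module R M] : Prop :=
  Subsingleton M ∨
    (relGrade (IsLocalRing.maximalIdeal R) M : WithBot ℕ∞) = moduleKrullDim R M

lemma aux_exactAt_iff {R : Type u} [CommRing R] {X : ModuleCat.{u} R} (P : ProjectiveResolution X)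
    (Y : ModuleCat.{u} R) (i : ℕ) :
    Subsingleton (((Ext R (ModuleCat.{u} R) i).obj (Opposite.op X)).obj Y) ↔
      (((P.complex.linearYonedaObj R Y).sc i).Exact) := by
  rw [← ModuleCat.isZero_iff_subsingleton, (P.isoExt (R := R) i Y).isZero_iff,
    ← HomologicalComplex.exactAt_iff_isZero_homology, HomologicalComplex.exactAt_iff]

lemma aux_ext_succ {R : Type u} [CommRing R] (X Y : ModuleCat.{u} R) (i : ℕ) :
    Subsingleton (((Ext R (ModuleCat.{u} R) (i+1)).obj (Opposite.op X)).obj Y) ↔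
      Subsingleton (Abelian.Ext X Y (i+1)) := by
  let P := ProjectiveResolution.of X
  rw [aux_exactAt_iff P, ← HomologicalComplex.exactAt_iff,
    HomologicalComplex.exactAt_iff' _ i (i+1) (i+2) (by simp) (by simp),
    ShortComplex.moduleCat_exact_iff]
  constructor
  · intro h
    refine ⟨fun a b => ?_⟩
    suffices ∀ a : Abelian.Ext X Y (i+1), a = 0 by rw [this a, this b]
    intro a
    obtain ⟨f, hf, rfl⟩ := P.extMk_surjective a (i+2) rfl
    rw [P.extMk_eq_zero_iff f _ rfl hf i rfl]
    obtain ⟨g, hg⟩ := h f hf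
    exact ⟨g, hg⟩
  · intro h f hf
    have := (P.extMk_eq_zero_iff f (i+2) rfl hf i rfl).1 (Subsingleton.elim _ _)
    exact this

lemma aux_ext_zero {R : Type u} [CommRing R] (X Y : ModuleCat.{u} R) :
    Subsingleton (((Ext R (ModuleCat.{u} R) 0).obj (Opposite.op X)).obj Y) ↔
      Subsingleton (Abelian.Ext X Y 0) := by
  let P := ProjectiveResolution.of X
  rw [aux_exactAt_iff P, ← HomologicalComplex.exactAt_iff,
    HomologicalComplex.exactAt_iff' _ 0 0 1 (by simp) (by simp),
    ShortComplex.moduleCat_exact_iff, Abelian.Ext.addEquiv₀.subsingleton_congr]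
  change _ ↔ Subsingleton (((ChainComplex.single₀ (ModuleCat.{u} R)).obj X).X 0 ⟶ Y)
  have h0 : (P.complex.linearYonedaObj R Y).d 0 0 = 0 :=
    HomologicalComplex.shape _ _ _ (by simp)
  constructor
  · intro h
    refine ⟨fun a b => ?_⟩
    suffices ∀ a : ((ChainComplex.single₀ (ModuleCat.{u} R)).obj X).X 0 ⟶ Y, a = 0 by rw [this a, this b]
    intro a
    have e : Epi (P.π.f 0) := inferInstance
    obtain ⟨g, hg⟩ := h (P.π.f 0 ≫ a) (by
      change P.complex.d 1 0 ≫ P.π.f 0 ≫ a = 0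
      rw [P.complex_d_comp_π_f_zero_assoc, Limits.zero_comp])
    have : P.π.f 0 ≫ a = 0 := by
      rw [← hg]
      change (P.complex.linearYonedaObj R Y).d 0 0 g = 0
      rw [h0]; rfl
    rw [← cancel_epi (P.π.f 0)]
    exact this.trans Limits.comp_zero.symm
  · intro h f hf
    refine ⟨0, ?_⟩
    have hf' : P.complex.d 1 0 ≫ f = 0 := hf
    have ex := P.exact₀
    have : f = 0 := by
      rw [← ex.g_desc f hf']
      have : ex.desc f hf' = 0 := Subsingleton.elim _ _
      rw [this]; exact Limits.comp_zero
    rw [map_zero, this]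

lemma aux_ext {R : Type u} [CommRing R] (X Y : ModuleCat.{u} R) (i : ℕ) :
    Subsingleton (((Ext R (ModuleCat.{u} R) i).obj (Opposite.op X)).obj Y) ↔
      Subsingleton (Abelian.Ext X Y i) := by
  cases i
  · exact aux_ext_zero X Y
  · exact aux_ext_succ X Y _


open IsLocalRing in
lemma aux_dim_le_zero_iff {R : Type u} [CommRing R] [IsLocalRing R]
    (M : Type u) [AddCommGroup M] [Module R M] [Module.Finite R M] :
    Module.supportDim R M ≤ 0 ↔ maximalIdeal R ≤ (Module.annihilator R M).radical := by
  rw [← PrimeSpectrum.zeroLocus_subset_zeroLocus_iff, ← Module.support_eq_zeroLocus]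
  constructor
  · intro h
    cases subsingleton_or_nontrivial M
    · simp [Module.support_eq_empty]
    · refine (support_of_supportDim_eq_zero R M (le_antisymm h ?_)).subset
      have := Module.supportDim_ne_bot_of_nontrivial R M
      rw [← WithBot.coe_unbot _ this]
      exact WithBot.coe_le_coe.mpr zero_le
  · intro h
    rw [PrimeSpectrum.zeroLocus_eq_singleton] at h
    rw [Module.supportDim]
    have : Subsingleton (Module.support R M) :=
      (Set.subsingleton_of_subset_singleton h).coe_sort
    exact Order.krullDim_nonpos_of_subsingleton

lemma aux_cancel {a : WithBot ℕ∞} {n : ℕ} (h : a + 1 ≤ ((n + 1 : ℕ) : WithBot ℕ∞)) :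
    a ≤ (n : WithBot ℕ∞) := by
  induction a with
  | bot => simp
  | coe a =>
    induction a with
    | top => exact absurd h (by
        rw [show ((⊤ : ℕ∞) : WithBot ℕ∞) + 1 = ((⊤ : ℕ∞) : WithBot ℕ∞) from rfl]
        exact not_le.mpr (WithBot.coe_lt_coe.mpr (ENat.natCast_lt_top _)))
    | coe a => norm_cast at h ⊢; omega

set_option linter.unusedSectionVars false

section
variable {R T : Type u} [CommRing R] [CommRing T]
    [IsLocalRing R] [IsLocalRing T] [Algebra R T]
    [IsNoetherianRing R] [IsNoetherianRing T]

open IsLocalRing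

/-- prime avoidance in `R` against finitely many primes of `T` not containing `𝔪T` -/
lemma aux_avoid {S : Set (Ideal T)} (hS : S.Finite) (hp : ∀ q ∈ S, q.IsPrime)
    (hrad : ((maximalIdeal R).map (algebraMap R T)).radical = maximalIdeal T)
    (hn : ∀ q ∈ S, q ≠ maximalIdeal T) :
    ∃ x ∈ maximalIdeal R, ∀ q ∈ S, algebraMap R T x ∉ q := by
  by_contra! hc
  have hsub : (maximalIdeal R : Set R) ⊆ ⋃ q ∈ S, (q.comap (algebraMap R T) : Set R) := by
    intro x hx
    obtain ⟨q, hq, hxq⟩ := hc x hx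
    exact Set.mem_biUnion hq hxq
  obtain ⟨q, hq, hle⟩ := (Ideal.subset_union_prime_finite hS (f := fun q : Ideal T =>
    q.comap (algebraMap R T)) ⊥ ⊥ (fun q hq _ _ => (hp q hq).comap _)).1 hsub
  have := hp q hq
  apply hn q hq
  refine le_antisymm (le_maximalIdeal this.ne_top) ?_
  rw [← hrad, this.radical_le_iff]
  exact Ideal.map_le_iff_le_comap.2 hle

lemma aux_inj (hpure : IsPureAlgebra R T) (M : Type u) [AddCommGroup M] [Module R M] :
    Function.Injective (TensorProduct.mk R T M 1) := hpure M

lemma aux_le (hrad : ((maximalIdeal R).map (algebraMap R T)).radical = maximalIdeal T)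
    (n : ℕ) : ∀ (M : Type u) [AddCommGroup M] [Module R M] [Module.Finite R M],
    Module.supportDim R M ≤ n → Module.supportDim T (T ⊗[R] M) ≤ n := by
  have base : ∀ (M : Type u) [AddCommGroup M] [Module R M] [Module.Finite R M],
    Module.supportDim R M ≤ 0 → Module.supportDim T (T ⊗[R] M) ≤ 0 := by
    intro M _ _ _ h
    rw [aux_dim_le_zero_iff] at h ⊢
    rw [← hrad, ← Ideal.radical_idem (Module.annihilator T _)]
    refine Ideal.radical_mono ?_
    rw [Ideal.map_le_iff_le_comap]
    intro x hx
    obtain ⟨k, hk⟩ := h hx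
    refine ⟨k, ?_⟩
    rw [← map_pow, Module.mem_annihilator]
    intro t
    rw [algebraMap_smul]
    induction t with
    | zero => simp
    | add a b ha hb => rw [smul_add, ha, hb, add_zero]
    | tmul a b => rw [← TensorProduct.tmul_smul, Module.mem_annihilator.1 hk, tmul_zero]
  induction n with
  | zero => exact_mod_cast base
  | succ n ih =>
    intro M _ _ _ h
    by_cases hc : maximalIdeal R ∈ (Module.annihilator R M).minimalPrimes
    · refine (base M ?_).trans (by exact_mod_cast Nat.zero_le _)
      rw [aux_dim_le_zero_iff, Ideal.radical_eq_sInf]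
      refine le_sInf fun J hJ => ?_
      exact hc.2 ⟨hJ.2, hJ.1⟩ (le_maximalIdeal hJ.2.ne_top)
    · obtain ⟨x, hx, hxq⟩ := aux_avoid (R := R) (T := R)
        (Ideal.finite_minimalPrimes_of_isNoetherianRing R (Module.annihilator R M))
        (fun q hq => hq.1.1) (by
          rw [Algebra.algebraMap_self, Ideal.map_id]
          exact (maximalIdeal.isMaximal R).isPrime.radical)
        (fun q hq he => hc (he ▸ hq))
      have h1 := Module.supportDim_quotSMulTop_succ_le_of_notMem_minimalPrimes hxq
      have h2 := ih _ (aux_cancel (h1.trans h))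
      have hx' : algebraMap R T x ∈ maximalIdeal T := by
        rw [← hrad]; exact Ideal.le_radical (Ideal.mem_map_of_mem _ hx)
      have h3 := Module.supportDim_le_supportDim_quotSMulTop_succ (M := T ⊗[R] M) hx'
      rw [Module.supportDim_eq_of_equiv
        (QuotSMulTop.algebraMapTensorEquivTensorQuotSMulTop x M T)] at h3
      refine h3.trans ?_
      push_cast
      gcongr
      exact h2

lemma aux_ge (hpure : IsPureAlgebra R T)
    (hrad : ((maximalIdeal R).map (algebraMap R T)).radical = maximalIdeal T)
    (n : ℕ) : ∀ (M : Type u) [AddCommGroup M] [Module R M] [Module.Finite R M],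
    Module.supportDim T (T ⊗[R] M) ≤ n → Module.supportDim R M ≤ n := by
  have base : ∀ (M : Type u) [AddCommGroup M] [Module R M] [Module.Finite R M],
    Module.supportDim T (T ⊗[R] M) ≤ 0 → Module.supportDim R M ≤ 0 := by
    intro M _ _ _ h
    rw [aux_dim_le_zero_iff] at h ⊢
    intro x hx
    have hx' : algebraMap R T x ∈ maximalIdeal T := by
      rw [← hrad]; exact Ideal.le_radical (Ideal.mem_map_of_mem _ hx)
    obtain ⟨k, hk⟩ := h hx'
    refine ⟨k, ?_⟩
    rw [← map_pow, Module.mem_annihilator] at hk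
    rw [Module.mem_annihilator]
    intro m
    apply aux_inj hpure M
    have := hk (1 ⊗ₜ m)
    rw [algebraMap_smul] at this
    rw [map_smul, map_zero]
    exact this
  induction n with
  | zero => exact_mod_cast base
  | succ n ih =>
    intro M _ _ _ h
    by_cases hc : maximalIdeal T ∈ (Module.annihilator T (T ⊗[R] M)).minimalPrimes
    · refine (base M ?_).trans (by exact_mod_cast Nat.zero_le _)
      rw [aux_dim_le_zero_iff, Ideal.radical_eq_sInf]
      refine le_sInf fun J hJ => ?_
      exact hc.2 ⟨hJ.2, hJ.1⟩ (le_maximalIdeal hJ.2.ne_top)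
    · obtain ⟨x, hx, hxq⟩ := aux_avoid (R := R) (T := T)
        (Ideal.finite_minimalPrimes_of_isNoetherianRing T (Module.annihilator T (T ⊗[R] M)))
        (fun q hq => hq.1.1) hrad (fun q hq he => hc (he ▸ hq))
      have h1 := Module.supportDim_quotSMulTop_succ_le_of_notMem_minimalPrimes hxq
      rw [Module.supportDim_eq_of_equiv
        (QuotSMulTop.algebraMapTensorEquivTensorQuotSMulTop x M T)] at h1
      have h2 := ih _ (aux_cancel (h1.trans h))
      have h3 := Module.supportDim_le_supportDim_quotSMulTop_succ (M := M) hx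
      refine h3.trans ?_
      push_cast
      gcongr

lemma aux_of_forall {a b : WithBot ℕ∞} (hb : b ≠ ⊥) (h : ∀ n : ℕ, b ≤ n → a ≤ n) : a ≤ b := by
  induction b with
  | bot => exact absurd rfl hb
  | coe b =>
    induction b with
    | top => exact le_top
    | coe b => exact h b le_rfl

lemma aux_dim_eq (hpure : IsPureAlgebra R T)
    (hrad : ((maximalIdeal R).map (algebraMap R T)).radical = maximalIdeal T)
    (M : Type u) [AddCommGroup M] [Module R M] [Module.Finite R M] :
    Module.supportDim T (T ⊗[R] M) = Module.supportDim R M := by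
  cases subsingleton_or_nontrivial M
  · rw [Module.supportDim_eq_bot_of_subsingleton, Module.supportDim_eq_bot_of_subsingleton]
  · have : Nontrivial (T ⊗[R] M) := (aux_inj hpure M).nontrivial
    exact le_antisymm
      (aux_of_forall (Module.supportDim_ne_bot_of_nontrivial R M) fun n => aux_le hrad n M)
      (aux_of_forall (Module.supportDim_ne_bot_of_nontrivial T _) fun n => aux_ge hpure hrad n M)

lemma aux_reg (hpure : IsPureAlgebra R T)
    (hrad : ((maximalIdeal R).map (algebraMap R T)).radical = maximalIdeal T)
    (d : ℕ) : ∀ (M : Type u) [AddCommGroup M] [Module R M] [Module.Finite R M] [Nontrivial M],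
    (∀ i < d, Subsingleton (Abelian.Ext (ModuleCat.of T (T ⧸ maximalIdeal T))
      (ModuleCat.of T (T ⊗[R] M)) i)) →
    ∃ rs : List R, rs.length = d ∧ (∀ r ∈ rs, r ∈ maximalIdeal R) ∧
      RingTheory.Sequence.IsRegular M rs := by
  induction d with
  | zero =>
    intro M _ _ _ _ _
    exact ⟨[], rfl, by simp, RingTheory.Sequence.IsRegular.nil R M⟩
  | succ d ih =>
    intro M _ _ _ _ h
    have h0 : Subsingleton (ModuleCat.of T (T ⧸ maximalIdeal T) ⟶ ModuleCat.of T (T ⊗[R] M)) :=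
      Abelian.Ext.addEquiv₀.subsingleton_congr.mp (h 0 d.zero_lt_succ)
    have h0' : Subsingleton ((T ⧸ maximalIdeal T) →ₗ[T] (T ⊗[R] M)) :=
      (ModuleCat.homAddEquiv (M := ModuleCat.of T (T ⧸ maximalIdeal T))
        (N := ModuleCat.of T (T ⊗[R] M))).symm.subsingleton
    obtain ⟨y, hy, hyreg⟩ := IsSMulRegular.subsingleton_linearMap_iff.mp h0'
    rw [Ideal.annihilator_quotient] at hy
    have hzd := biUnion_associatedPrimes_eq_zero_divisors T (T ⊗[R] M)
    obtain ⟨x, hx, hxq⟩ := aux_avoid (R := R) (T := T)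
        (associatedPrimes.finite T (T ⊗[R] M)) (fun q hq => hq.1) hrad (by
          intro q hq he
          have : y ∈ ⋃ p ∈ associatedPrimes T (T ⊗[R] M), (p : Set T) :=
            Set.mem_biUnion hq (by rw [he]; exact hy)
          rw [hzd] at this
          obtain ⟨z, hz, hyz⟩ := this
          exact hz (hyreg.right_eq_zero_of_smul hyz))
    have hxT : IsSMulRegular (T ⊗[R] M) (algebraMap R T x) := by
      intro a b hab
      by_contra hab'
      have hne : a - b ≠ 0 := sub_ne_zero.2 hab'
      have hz : algebraMap R T x • (a - b) = 0 := by
        rw [smul_sub, sub_eq_zero]; exact hab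
      have : algebraMap R T x ∈ ⋃ p ∈ associatedPrimes T (T ⊗[R] M), (p : Set T) := by
        rw [hzd]; exact ⟨_, hne, hz⟩
      simp only [Set.mem_iUnion] at this
      obtain ⟨q, hq, hxq'⟩ := this
      exact hxq q hq hxq'
    have hxR : IsSMulRegular (T ⊗[R] M) x := by
      intro a b hab
      apply hxT
      simpa only [algebraMap_smul] using hab
    have hxM : IsSMulRegular M x := hxR.of_injective (TensorProduct.mk R T M 1) (aux_inj hpure M)
    have : Nontrivial (QuotSMulTop x M) := by
      rw [← Module.supportDim_ne_bot_iff_nontrivial R]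
      intro hb
      have := Module.supportDim_quotSMulTop_succ_eq_supportDim hxM hx
      rw [hb] at this
      exact Module.supportDim_ne_bot_of_nontrivial R M this.symm
    obtain ⟨rs, hl, hm, hr⟩ := ih (QuotSMulTop x M) (by
      intro i hi
      have s : Subsingleton (Abelian.Ext (ModuleCat.of T (T ⧸ maximalIdeal T))
          (ModuleCat.of T (QuotSMulTop (algebraMap R T x) (T ⊗[R] M))) i) := by
        have zero1 := AddCommGrpCat.isZero_of_iff_subsingleton.mpr (h i (by omega))
        have zero2 := AddCommGrpCat.isZero_of_iff_subsingleton.mpr (h (i + 1) (by omega))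
        have hse := IsSMulRegular.smulShortComplex_shortExact
          (M := ModuleCat.of T (T ⊗[R] M)) hxT
        exact AddCommGrpCat.subsingleton_of_isZero <| ShortComplex.Exact.isZero_of_both_zeros
          ((Abelian.Ext.covariant_sequence_exact₃' (ModuleCat.of T (T ⧸ maximalIdeal T)) hse)
            i (i + 1) rfl)
          (zero1.eq_zero_of_src _) (zero2.eq_zero_of_tgt _)
      rw [← aux_ext] at s ⊢
      exact (ModuleCat.isZero_iff_subsingleton.1 ((Functor.mapIso _
        (QuotSMulTop.algebraMapTensorEquivTensorQuotSMulTop x M T).toModuleIso).isZero_iff.1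
          (ModuleCat.isZero_iff_subsingleton.2 s))))
    refine ⟨x :: rs, by simp [hl], List.forall_mem_cons.2 ⟨hx, hm⟩, ?_⟩
    exact RingTheory.Sequence.IsRegular.cons hxM hr

end

lemma aux_grade_subsingleton {R : Type u} [CommRing R] (a : Ideal R)
    (M : Type u) [AddCommGroup M] [Module R M] {d i : ℕ} (h : relGrade a M = d) (hi : i < d) :
    Subsingleton (Abelian.Ext (ModuleCat.of R (R ⧸ a)) (ModuleCat.of R M) i) := by
  rw [← aux_ext]
  by_contra hc
  rw [not_subsingleton_iff_nontrivial] at hc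
  have : relGrade a M ≤ i := sInf_le ⟨i, hc, rfl⟩
  rw [h] at this
  exact absurd (by exact_mod_cast this) (not_le.mpr hi)

open IsLocalRing in
lemma aux_depth {R : Type u} [CommRing R] [IsLocalRing R] [IsNoetherianRing R]
    (M : Type u) [AddCommGroup M] [Module R M] [Module.Finite R M] [Nontrivial M] (d : ℕ)
    (hd : Module.supportDim R M = d)
    (h : ∃ rs : List R, rs.length = d ∧ (∀ r ∈ rs, r ∈ maximalIdeal R) ∧
      RingTheory.Sequence.IsRegular M rs) : relGrade (maximalIdeal R) M = d := by
  have lt : maximalIdeal R • (⊤ : Submodule R M) < ⊤ := by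
    rw [lt_top_iff_ne_top]
    intro he
    exact Submodule.top_ne_ideal_smul_of_le_jacobson_annihilator
      (maximalIdeal_le_jacobson _) he.symm
  have hsupp : Module.support R (R ⧸ maximalIdeal R) =
      PrimeSpectrum.zeroLocus (maximalIdeal R : Set R) := by
    rw [Module.support_eq_zeroLocus, Ideal.annihilator_quotient]
  obtain ⟨rs, hl, hm, hr⟩ := h
  have hvan := ModuleCat.subsingleton_ext_of_exists_isRegular (maximalIdeal R)
    (ModuleCat.of R (R ⧸ maximalIdeal R)) hsupp.subset (ModuleCat.of R M) lt rs hm hr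
  have hne : ¬ Subsingleton (Abelian.Ext (ModuleCat.of R (R ⧸ maximalIdeal R))
      (ModuleCat.of R M) d) := by
    intro hs
    obtain ⟨rs', hl', hm', hr'⟩ := ModuleCat.exists_isRegular_of_exists_subsingleton_ext
      (maximalIdeal R) (d + 1) (ModuleCat.of R M) lt (ModuleCat.of R (R ⧸ maximalIdeal R)) hsupp
      (by
        intro i hi
        rcases Nat.lt_succ_iff_lt_or_eq.1 hi with h | rfl
        · exact hvan i (hl ▸ h)
        · exact hs)
    have := Module.supportDim_add_length_eq_supportDim_of_isRegular rs' hr'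
    rw [hl', show Module.supportDim R (ModuleCat.of R M) = d from hd] at this
    generalize Module.supportDim R ((ModuleCat.of R M : Type u) ⧸
      Ideal.ofList rs' • (⊤ : Submodule R (ModuleCat.of R M))) = a at this
    induction a with
    | bot => simp at this
    | coe a =>
      induction a with
      | top => exact absurd (WithBot.coe_injective this :
          (⊤ : ℕ∞) + ((d + 1 : ℕ) : ℕ∞) = (d : ℕ∞)) (by simp)
      | coe a => norm_cast at this; omega
  apply le_antisymm
  · refine sInf_le ⟨d, ?_, rfl⟩
    rw [← aux_ext, not_subsingleton_iff_nontrivial] at hne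
    exact hne
  · refine le_sInf ?_
    rintro _ ⟨i, hi, rfl⟩
    by_contra hc
    have hc' : i < d := by
      rw [not_le] at hc; exact Nat.cast_lt.1 hc
    have := hvan i (hl ▸ hc')
    rw [← aux_ext] at this
    exact not_subsingleton_iff_nontrivial.2 hi this

theorem stmt7 {R T : Type u} [CommRing R] [CommRing T]
    [IsLocalRing R] [IsLocalRing T] [Algebra R T] [IsLocalHom (algebraMap R T)]
    [IsNoetherianRing R] [IsNoetherianRing T]
    (hpure : IsPureAlgebra R T)
    (hrad : ((IsLocalRing.maximalIdeal R).map (algebraMap R T)).radical =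
      IsLocalRing.maximalIdeal T)
    (M : Type u) [AddCommGroup M] [Module R M] [Module.Finite R M] :
    moduleKrullDim T (T ⊗[R] M) = moduleKrullDim R M ∧
      (IsCMModule T (T ⊗[R] M) → IsCMModule R M) := by
  have hfd : ∀ {A : Type u} [CommRing A] (N : Type u) [AddCommGroup N] [Module A N]
      [Module.Finite A N], moduleKrullDim A N = Module.supportDim A N := fun N =>
    (Module.supportDim_eq_ringKrullDim_quotient_annihilator _ N).symm
  have hdim := aux_dim_eq hpure hrad M
  rw [hfd, hfd]
  refine ⟨hdim, fun hCM => ?_⟩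
  cases subsingleton_or_nontrivial M with
  | inl hs => exact Or.inl hs
  | inr hnt =>
    right
    have hntT : Nontrivial (T ⊗[R] M) := (aux_inj hpure M).nontrivial
    rcases hCM with hs | hCM
    · exact absurd hs (not_subsingleton_iff_nontrivial.2 hntT)
    rw [hfd, hdim] at hCM
    rw [hfd]
    have hlt : Module.supportDim R M < ⊤ :=
      (Module.supportDim_le_ringKrullDim R M).trans_lt ringKrullDim_lt_top
    rw [← hCM] at hlt
    obtain ⟨d, hd⟩ := ENat.ne_top_iff_exists.1 (WithBot.coe_lt_coe.1 hlt).ne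
    rw [← hd] at hCM
    rw [← hCM, aux_depth M d hCM.symm (aux_reg hpure hrad d M
      fun i hi => aux_grade_subsingleton _ _ hd.symm hi)]

end
end
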